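/- arXiv:1406.0107 — 2 statements merged into one kernel-verified Lean document; each statement's English description precedes it below -/
import Mathlib

section
/- Let q be an odd prime power, d ≥ 2, E ⊆ 𝔽_q^d, and t ∈ 𝔽_q nonzero. Then |{(x,y) ∈ E × E : ‖x−y‖ = t}| = |E|^2/q + R(t), where |R(t)| ≤ 2·q^{(d−1)/2}·|E|. -/
namespace FalcHelp

open Polynomial Finset

noncomputable def stepW {F : Type} [Field F] (q n : ℕ) (a : F) : F[X] :=
  ∑ i ∈ range (n + 1), (X ^ (q ^ n + q ^ i) + C a * X ^ (q ^ n - q ^ i))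

lemma stepW_monic {F : Type} [Field F] (q n : ℕ) (hq : 2 ≤ q) (a : F) :
    (stepW q n a).Monic ∧ (stepW q n a).natDegree = 2 * q ^ n := by
  have he : 0 < q ^ n := by positivity
  have h : stepW q n a = X ^ (2 * q ^ n) +
      (∑ i ∈ range n, (X ^ (q ^ n + q ^ i) + C a * X ^ (q ^ n - q ^ i)) + C a) := by
    unfold stepW
    rw [sum_range_succ]
    simp only [Nat.sub_self, pow_zero, mul_one, two_mul]
    ring
  have hd : (∑ i ∈ range n, (X ^ (q ^ n + q ^ i) + C a * X ^ (q ^ n - q ^ i)) + C a : F[X]).degree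
      < ((2 * q ^ n : ℕ) : WithBot ℕ) := by
    refine (degree_add_le _ _).trans_lt (max_lt ?_ ?_)
    · refine (degree_sum_le _ _).trans_lt ?_
      rw [Finset.sup_lt_iff (WithBot.bot_lt_coe _)]
      intro i hi
      have hi' : q ^ i < q ^ n := Nat.pow_lt_pow_right (by omega) (mem_range.1 hi)
      refine (degree_add_le _ _).trans_lt (max_lt ?_ ?_)
      · rw [degree_X_pow]; exact_mod_cast (by omega)
      · refine (degree_C_mul_X_pow_le _ _).trans_lt ?_
        exact_mod_cast (by omega)
    · refine degree_C_le.trans_lt ?_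
      exact_mod_cast (by omega)
  rw [h]
  refine ⟨monic_X_pow_add hd, ?_⟩
  rw [natDegree_add_eq_left_of_degree_lt (by rwa [degree_X_pow]), natDegree_X_pow]

/-- linear algebra step -/
lemma exists_relation {F : Type} [Field F] {I : Type} [Fintype I] (P : I → F[X]) (M : ℕ)
    (hP : ∀ i, (P i).natDegree < M) (hM : M < Fintype.card I) :
    ∃ σ : I → F, σ ≠ 0 ∧ ∑ i, C (σ i) * P i = 0 := by
  let f : (I → F) →ₗ[F] (Fin M → F) :=
    { toFun := fun σ k => ∑ i, σ i * (P i).coeff k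
      map_add' := by intro x y; ext k; simp [add_mul, sum_add_distrib]
      map_smul' := by intro x y; ext k; simp [mul_assoc, mul_sum] }
  have hk : LinearMap.ker f ≠ ⊥ := f.ker_ne_bot_of_finrank_lt (by simpa using hM)
  obtain ⟨σ, hσ, hσ0⟩ := (Submodule.ne_bot_iff _).mp hk
  refine ⟨σ, hσ0, ?_⟩
  ext k
  simp only [finsetSum_coeff, coeff_C_mul, coeff_zero]
  by_cases hkM : k < M
  · have := congrFun (LinearMap.mem_ker.1 hσ) ⟨k, hkM⟩
    simpa [f] using this
  · refine sum_eq_zero fun i _ => ?_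
    rw [coeff_eq_zero_of_natDegree_lt ((hP i).trans_le (not_lt.1 hkM)), mul_zero]

lemma sum_ne_zero_of_degrees {F : Type} [Field F] {I : Type} [Fintype I] (P : I → F[X])
    (hP0 : ∀ i, P i ≠ 0)
    (hP : Function.Injective fun i => (P i).natDegree) (σ : I → F) (hσ : σ ≠ 0) :
    ∑ i, C (σ i) * P i ≠ 0 := by
  obtain ⟨i, hi⟩ := Function.ne_iff.1 hσ
  intro h0
  have := degree_sum_eq_of_disjoint (fun i => C (σ i) * P i) univ ?_
  · rw [h0, degree_zero] at this
    have h1 := (Finset.sup_eq_bot_iff _ _).1 this.symm i (mem_univ _)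
    rw [degree_eq_bot] at h1
    exact mul_ne_zero (C_ne_zero.2 hi) (hP0 i) h1
  · rintro j ⟨-, hj⟩ k ⟨-, hk⟩ hjk hd
    apply hjk
    apply hP
    have hj' : C (σ j) ≠ 0 := fun h => hj (by simp [h])
    have hk' : C (σ k) ≠ 0 := fun h => hk (by simp [h])
    have := natDegree_eq_of_degree_eq hd
    simp only at this
    rwa [natDegree_C_mul (by simpa using hj'), natDegree_C_mul (by simpa using hk')] at this

lemma stepW_aeval {F L : Type} [Field F] [Field L] [Fintype F] [Algebra F L]
    (n : ℕ) (a : F) (x : L) (hx : x ≠ 0) :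
    aeval x (stepW (Fintype.card F) n a) = x ^ (Fintype.card F ^ n) *
      ∑ i ∈ range (n + 1), (x + algebraMap F L a / x) ^ (Fintype.card F ^ i) := by
  have hc : ∀ (i : ℕ) (y : L), (FiniteField.frobeniusAlgHom F L ^ i) y = y ^ (Fintype.card F ^ i) := by
    intro i y
    rw [AlgHom.coe_pow, FiniteField.coe_frobeniusAlgHom, pow_iterate]
  have hq : 0 < Fintype.card F := Fintype.card_pos
  unfold stepW
  rw [map_sum, mul_sum]
  refine sum_congr rfl fun i hi => ?_
  have hle : Fintype.card F ^ i ≤ Fintype.card F ^ n :=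
    Nat.pow_le_pow_right hq (by have := mem_range.1 hi; omega)
  rw [← hc i (x + _), map_add (FiniteField.frobeniusAlgHom F L ^ i), map_div₀ (FiniteField.frobeniusAlgHom F L ^ i), hc, hc, ← map_pow, FiniteField.pow_card_pow]
  simp only [map_add, map_mul, map_pow, aeval_X, aeval_C]
  rw [pow_sub₀ _ hx hle, pow_add]
  field_simp

theorem stepanov {F L : Type} [Field F] [Fintype F] [DecidableEq F] [Field L] [Fintype L]
    [DecidableEq L] [Algebra F L] (n : ℕ) (hn : Module.finrank F L = 2 * (n + 1)) (a c : F) :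
    (univ.filter fun x : L => x ≠ 0 ∧ Algebra.trace F L (x + algebraMap F L a / x) = c).card ≤
      Fintype.card F ^ (2 * n + 1) + 6 * Fintype.card F ^ (n + 1) := by
  have hcardF : 2 ≤ Fintype.card F := Fintype.one_lt_card
  have hc : ∀ (i : ℕ) (y : L), (FiniteField.frobeniusAlgHom F L ^ i) y = y ^ (Fintype.card F ^ i) := by
    intro i y
    rw [AlgHom.coe_pow, FiniteField.coe_frobeniusAlgHom, pow_iterate]
  have hNat : Nat.card F = Fintype.card F := Nat.card_eq_fintype_card
  have hL : Fintype.card L = Fintype.card F ^ (2 * (n + 1)) := by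
    rw [← hn]; exact Module.card_eq_pow_finrank
  obtain ⟨hWm, hWd⟩ := stepW_monic (Fintype.card F) n hcardF a
  have hWa := fun x hx => stepW_aeval (L := L) n a x hx
  have htr := fun x : L => FiniteField.algebraMap_trace_eq_sum_pow F L x
  rw [hn] at htr
  simp only [hNat] at htr
  generalize hW : stepW (Fintype.card F) n a = W at *
  generalize hq : Fintype.card F = q at *
  generalize he : q ^ n = e at *
  have hepos : 0 < e := by rw [← he]; positivity
  have hr : q ^ (n + 1) = e * q := by rw [pow_succ, he]
  have hQ : q ^ (2 * n + 1) = e * (e * q) := by rw [← he]; ring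
  have hQ2 : q ^ (2 * (n + 1)) = (e * q) * (e * q) := by rw [← he]; ring
  have her : 2 ≤ e * q := by nlinarith
  let I := Fin q × Fin (e + 4) × Fin e
  let V : F[X] := C c * X ^ e - W
  have hVd : V.natDegree ≤ 2 * e := by
    refine (natDegree_sub_le _ _).trans (max_le ?_ hWd.le)
    exact (natDegree_C_mul_X_pow_le _ _).trans (by omega)
  let P : I → F[X] := fun i => X ^ (e * q * i.2.2 + i.2.1) * (V ^ (i.1 : ℕ) * X ^ (e * (q - 1 - i.1)))
  let G : I → F[X] := fun i => X ^ (i.2.2 + e * q * i.2.1) * (W ^ (i.1 : ℕ) * X ^ (e * (q - 1 - i.1)))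
  have hjj : ∀ j : Fin q, (j : ℕ) * (2 * e) + e * (q - 1 - j) = e * j + e * (q - 1) := by
    intro j
    have : q - 1 = (q - 1 - j) + j := by omega
    rw [this]; simp only [Nat.add_sub_cancel]; ring
  have hPd : ∀ i, (P i).natDegree < e * (e * q) + e * q + 4 := by
    rintro ⟨j, i, k⟩
    have h1 : (P (j, i, k)).natDegree ≤ (e * q * k + i) + ((j : ℕ) * (2 * e) + e * (q - 1 - j)) := by
      refine natDegree_mul_le.trans (Nat.add_le_add (by simp) ?_)
      refine natDegree_mul_le.trans (Nat.add_le_add ?_ (by simp))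
      exact natDegree_pow_le.trans (Nat.mul_le_mul_left _ hVd)
    rw [hjj] at h1
    refine h1.trans_lt ?_
    have hk : (k : ℕ) + 1 ≤ e := k.2
    have hj : (j : ℕ) ≤ q - 1 := by omega
    have hi : (i : ℕ) ≤ e + 3 := by omega
    obtain ⟨q', rfl⟩ : ∃ q', q = q' + 1 := ⟨q - 1, by omega⟩
    simp only [Nat.add_sub_cancel] at *
    have h2 : e * (q' + 1) * (k + 1) ≤ e * (q' + 1) * e := Nat.mul_le_mul_left _ hk
    have h3 : e * (j : ℕ) ≤ e * q' := Nat.mul_le_mul_left _ hj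
    nlinarith
  have hGd : ∀ i : I, (G i).natDegree = (i.2.2 + e * q * i.2.1) + (e * i.1 + e * (q - 1)) := by
    rintro ⟨j, i, k⟩
    simp only [G]
    rw [← hjj, Monic.natDegree_mul (monic_X_pow _) ((hWm.pow _).mul (monic_X_pow _)),
      Monic.natDegree_mul (hWm.pow _) (monic_X_pow _), hWm.natDegree_pow, hWd]
    simp
  have hG0 : ∀ i, G i ≠ 0 := fun i =>
    ((monic_X_pow _).mul ((hWm.pow _).mul (monic_X_pow _))).ne_zero
  have hGinj : Function.Injective fun i => (G i).natDegree := by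
    rintro ⟨j, i, k⟩ ⟨j', i', k'⟩ h
    simp only [hGd] at h
    have h1 : (k : ℕ) + e * (j + q * i) = k' + e * (j' + q * i') := by linarith
    have hk : (k : ℕ) = k' := by
      have := congrArg (· % e) h1
      simpa [Nat.add_mul_mod_self_left, Nat.mod_eq_of_lt k.2, Nat.mod_eq_of_lt k'.2] using this
    have h2 : (j : ℕ) + q * i = j' + q * i' := by
      rw [hk] at h1
      exact Nat.eq_of_mul_eq_mul_left hepos (Nat.add_left_cancel h1)
    have hj : (j : ℕ) = j' := by
      have := congrArg (· % q) h2
      simpa [Nat.add_mul_mod_self_left, Nat.mod_eq_of_lt j.2, Nat.mod_eq_of_lt j'.2] using this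
    have hi : (i : ℕ) = i' := by
      rw [hj] at h2
      exact Nat.eq_of_mul_eq_mul_left (by omega) (Nat.add_left_cancel h2)
    exact Prod.ext (Fin.ext hj) (Prod.ext (Fin.ext hi) (Fin.ext hk))
  obtain ⟨σ, hσ0, hσ⟩ := exists_relation P _ hPd (by
    simp only [I, Fintype.card_prod, Fintype.card_fin]
    nlinarith)
  have hΨ0 := sum_ne_zero_of_degrees G hG0 hGinj σ hσ0
  set Ψ := ∑ i, C (σ i) * G i with hΨ
  have hΨd : Ψ.natDegree ≤ e * (e * q) + 6 * (e * q) := by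
    refine natDegree_sum_le_of_forall_le _ _ fun i _ => ?_
    refine (natDegree_C_mul_le _ _).trans ?_
    rw [hGd]
    obtain ⟨j, i, k⟩ := i
    change (k : ℕ) + e * q * i + (e * j + e * (q - 1)) ≤ _
    have hk : (k : ℕ) + 1 ≤ e := k.2
    have hj : (j : ℕ) ≤ q - 1 := by omega
    have hi : (i : ℕ) ≤ e + 3 := by omega
    obtain ⟨q', rfl⟩ : ∃ q', q = q' + 1 := ⟨q - 1, by omega⟩
    simp only [Nat.add_sub_cancel] at *
    have h2 : e * (q' + 1) * i ≤ e * (q' + 1) * (e + 3) := Nat.mul_le_mul_left _ hi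
    have h3 : e * (j : ℕ) ≤ e * q' := Nat.mul_le_mul_left _ hj
    nlinarith
  rw [hr, hQ]
  refine le_trans ?_ hΨd
  have hmap0 : Ψ.map (algebraMap F L) ≠ 0 := by
    rwa [Ne, Polynomial.map_eq_zero]
  rw [← natDegree_map (algebraMap F L)]
  refine le_trans ?_ (card_roots' _)
  refine le_trans (card_le_card ?_) (Multiset.toFinset_card_le _)
  intro x hx
  obtain ⟨hx0, hxt⟩ := (mem_filter.1 hx).2
  rw [Multiset.mem_toFinset, mem_roots hmap0, IsRoot.def, eval_map_algebraMap]
  set w := ∑ i ∈ range (n + 1), (x + algebraMap F L a / x) ^ (q ^ i) with hw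
  have hWx : aeval x W = x ^ e * w := hWa x hx0
  have hww : w ^ (e * q) = algebraMap F L c - w := by
    have h1 : algebraMap F L c = ∑ i ∈ range ((n + 1) + (n + 1)), (x + algebraMap F L a / x) ^ (q ^ i) := by
      rw [← hxt, htr, two_mul]
    rw [sum_range_add, ← hw] at h1
    rw [h1, add_sub_cancel_left, ← hr, ← hc (n + 1), hw, map_sum]
    refine sum_congr rfl fun i _ => ?_
    rw [hc, ← pow_mul, ← pow_add, add_comm i]
  have hVx : aeval x V = x ^ e * (algebraMap F L c - w) := by
    simp only [V, map_sub, map_mul, aeval_C, map_pow, aeval_X, hWx]; ring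
  have hxQ : x ^ ((e * q) * (e * q)) = x := by
    rw [← hQ2, ← hL]; exact FiniteField.pow_card x
  have hexp : ∀ j : Fin q, x ^ (e * (j : ℕ)) * x ^ (e * (q - 1 - j)) = x ^ (e * (q - 1)) := by
    intro j
    rw [← pow_add, ← mul_add]; congr 2; omega
  have hPx : (0 : L) = x ^ (e * (q - 1)) *
      ∑ i : I, algebraMap F L (σ i) * (x ^ (e * q * i.2.2 + i.2.1) * (algebraMap F L c - w) ^ (i.1 : ℕ)) := by
    rw [← map_zero (aeval x : F[X] →ₐ[F] L), ← hσ, map_sum, mul_sum]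
    refine sum_congr rfl fun i _ => ?_
    simp only [P, map_mul, aeval_C, map_pow, aeval_X, hVx]
    rw [← hexp i.1, mul_pow, ← pow_mul]; ring
  have hGx : aeval x Ψ = x ^ (e * (q - 1)) *
      ∑ i : I, algebraMap F L (σ i) * (x ^ (i.2.2 + e * q * i.2.1) * w ^ (i.1 : ℕ)) := by
    rw [hΨ, map_sum, mul_sum]
    refine sum_congr rfl fun i _ => ?_
    simp only [G, map_mul, aeval_C, map_pow, aeval_X, hWx]
    rw [← hexp i.1, mul_pow, ← pow_mul]; ring
  rw [hGx]
  refine mul_eq_zero_of_right _ ?_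
  have hP2 := (mul_eq_zero.1 hPx.symm).resolve_left (pow_ne_zero _ hx0)
  have : (FiniteField.frobeniusAlgHom F L ^ (n + 1)) (∑ i : I, algebraMap F L (σ i) * (x ^ (i.2.2 + e * q * i.2.1) * w ^ (i.1 : ℕ))) = 0 := by
    rw [← hP2, map_sum]
    refine sum_congr rfl fun i _ => ?_
    rw [map_mul, AlgHom.commutes, map_mul, map_pow _ w, hc _ w, hr, hww, hc, hr]
    congr 2
    rw [← pow_mul, add_mul, pow_add, pow_add, mul_comm (i.2.2 : ℕ)]
    congr 1
    rw [mul_right_comm, pow_mul, hxQ]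
  exact (map_eq_zero _).1 this

lemma sum_sq_eq {K : Type} [Field K] [Fintype K] [DecidableEq K] (hK : ringChar K ≠ 2) (h : K → ℂ) :
    ∑ v, h (v ^ 2) = ∑ D, (((quadraticChar K D : ℤ) : ℂ) + 1) * h D := by
  rw [← Finset.sum_fiberwise_of_maps_to (s := univ) (t := univ) (g := fun v : K => v ^ 2) (by simp)]
  refine sum_congr rfl fun D _ => ?_
  rw [sum_congr rfl (g := fun _ => h D) (by intro v hv; rw [(mem_filter.1 hv).2]), sum_const, nsmul_eq_mul]
  congr 1
  have := quadraticChar_card_sqrts hK D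
  rw [Set.toFinset_ofPred] at this
  exact_mod_cast congrArg (fun z : ℤ => (z : ℂ)) this

lemma sum_sq_add {K : Type} [Field K] [Fintype K] [DecidableEq K] (hK : ringChar K ≠ 2)
    (δ : K) (hδ : ¬ IsSquare δ) (h : K → ℂ) :
    ∑ v, h (v ^ 2) + ∑ v, h (δ * v ^ 2) = 2 * ∑ D, h D := by
  have hδ0 : δ ≠ 0 := fun h0 => hδ (by simp [h0])
  rw [sum_sq_eq hK, sum_sq_eq hK (fun D => h (δ * D))]
  have h1 : ∑ D, (((quadraticChar K D : ℤ) : ℂ) + 1) * h D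
      = ∑ D, (((quadraticChar K (δ * D) : ℤ) : ℂ) + 1) * h (δ * D) :=
    (Equiv.sum_comp (Equiv.mulLeft₀ δ hδ0) (fun D => (((quadraticChar K D : ℤ) : ℂ) + 1) * h D)).symm
  have h2 : ∑ D, h D = ∑ D, h (δ * D) := (Equiv.sum_comp (Equiv.mulLeft₀ δ hδ0) h).symm
  rw [h1, h2, ← sum_add_distrib, mul_sum]
  refine sum_congr rfl fun D _ => ?_
  rw [map_mul, quadraticChar_neg_one_iff_not_isSquare.2 hδ]
  push_cast; ring

lemma quad_trace {K : Type} [Field K] (δ : K) (z : QuadraticAlgebra K δ 0) :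
    Algebra.trace K (QuadraticAlgebra K δ 0) z = 2 * z.re := by
  rw [Algebra.trace_eq_matrix_trace (QuadraticAlgebra.basis δ 0), Matrix.trace_fin_two]
  simp [Algebra.leftMulMatrix_eq_repr_mul, QuadraticAlgebra.basis, QuadraticAlgebra.linearEquivTuple, QuadraticAlgebra.equivProd]
  ring

open Classical in
noncomputable def trS (F L : Type) [Field F] [Field L] [Fintype L] [Algebra F L]
    (ψ : AddChar F ℂ) (a : F) : ℂ :=
  ∑ z : L, if z = 0 then 0 else ψ (Algebra.trace F L (z + algebraMap F L a / z))

open Classical in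
lemma quad_step {K : Type} [Field K] [Fintype K] (hK : ringChar K ≠ 2)
    (δ : K) (hδ : ¬ IsSquare δ) [Fact (∀ r : K, r ^ 2 ≠ δ + 0 * r)] [Fintype (QuadraticAlgebra K δ 0)]
    (ψ : AddChar K ℂ) (hψ : ψ.IsPrimitive) (a : K) (ha : a ≠ 0) :
    trS K (QuadraticAlgebra K δ 0) ψ a + trS K K ψ a ^ 2 = 2 * Fintype.card K := by
  have h2 : (2 : K) ≠ 0 := Ring.two_ne_zero hK
  let g : K → K → ℂ := fun u D => if u ^ 2 - D = 0 then 0 else ψ (2 * u + 2 * a * u / (u ^ 2 - D))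
  have hL : trS K (QuadraticAlgebra K δ 0) ψ a = ∑ u, ∑ v, g u (δ * v ^ 2) := by
    unfold trS
    rw [← Fintype.sum_prod_type' (fun u v => g u (δ * v ^ 2)),
      ← (QuadraticAlgebra.equivProd δ 0).sum_comp (fun p => g p.1 (δ * p.2 ^ 2))]
    refine sum_congr rfl fun z _ => ?_
    have hn : z.norm = z.re ^ 2 - δ * z.im ^ 2 := by
      rw [QuadraticAlgebra.norm_def]; ring
    simp only [g, QuadraticAlgebra.equivProd, Equiv.coe_fn_mk, ← hn,
      QuadraticAlgebra.norm_eq_zero_iff_eq_zero]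
    split_ifs with h0
    · rfl
    · congr 1
      rw [quad_trace, div_eq_mul_inv]
      simp [QuadraticAlgebra.algebraMap_eq, QuadraticAlgebra.re_inv]
      ring
  have hKK : trS K K ψ a ^ 2 = ∑ u, ∑ v, g u (v ^ 2) := by
    unfold trS
    rw [sq, sum_mul_sum, ← Fintype.sum_prod_type', ← Fintype.sum_prod_type' (fun u v => g u (v ^ 2))]
    let eqv : K × K ≃ K × K :=
      { toFun := fun p => (p.1 + p.2, p.1 - p.2)
        invFun := fun p => ((p.1 + p.2) / 2, (p.1 - p.2) / 2)
        left_inv := by intro p; ext <;> simp <;> field_simp <;> ring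
        right_inv := by intro p; ext <;> simp <;> field_simp <;> ring }
    rw [← eqv.sum_comp]
    refine sum_congr rfl fun p _ => ?_
    obtain ⟨u, v⟩ := p
    have hf : u ^ 2 - v ^ 2 = (u + v) * (u - v) := by ring
    simp only [g, eqv, Equiv.coe_fn_mk, Algebra.trace_self, LinearMap.id_apply, Algebra.algebraMap_self_apply, hf, mul_eq_zero]
    by_cases hp : u + v = 0
    · simp [hp]
    by_cases hm : u - v = 0
    · simp [hm]
    simp only [hp, hm, if_false, or_self]
    rw [← AddChar.map_add_eq_mul]
    congr 1
    field_simp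
    ring
  rw [hL, hKK, add_comm, ← sum_add_distrib]
  simp_rw [sum_sq_add hK δ hδ]
  rw [← mul_sum]
  congr 1
  have h3 : ∀ u, ∑ D, g u D = ∑ p, if p = 0 then 0 else ψ (u * (2 * (1 + a / p))) := by
    intro u
    rw [← (Equiv.subLeft (u ^ 2)).sum_comp]
    refine sum_congr rfl fun p _ => ?_
    simp only [g, Equiv.subLeft_apply, sub_sub_cancel]
    split_ifs
    · rfl
    · congr 1; ring
  simp_rw [h3]
  rw [sum_comm, sum_eq_single (-a)]
  · rw [sum_congr rfl (g := fun _ => (1 : ℂ))]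
    · simp
    · intro u _
      simp [ha]
  · intro p _ hp
    by_cases hp0 : p = 0
    · simp [hp0]
    simp only [hp0, if_false]
    rw [AddChar.sum_mulShift _ hψ, if_neg]
    · simp
    · apply mul_ne_zero h2
      intro h
      apply hp
      field_simp at h
      linear_combination h
  · simp

lemma char_tr_primitive {F K : Type} [Field F] [Field K] [Fintype F] [Fintype K] [Algebra F K]
    (ψ : AddChar F ℂ) (hψ : ψ.IsPrimitive) :
    (ψ.compAddMonoidHom (Algebra.trace F K).toAddMonoidHom).IsPrimitive := by
  apply AddChar.IsPrimitive.of_ne_one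
  have h1 : ψ ≠ 1 := by
    have := hψ one_ne_zero
    rwa [AddChar.mulShift_one] at this
  obtain ⟨x, hx⟩ := AddChar.ne_one_iff.1 h1
  obtain ⟨y, hy⟩ := Algebra.trace_surjective F K x
  exact AddChar.ne_one_iff.2 ⟨y, by simpa [hy] using hx⟩

lemma tower {F : Type} [Field F] [Fintype F] (hF : ringChar F ≠ 2) (ψ : AddChar F ℂ)
    (hψ : ψ.IsPrimitive) (a : F) (ha : a ≠ 0) (ε : ℝ) (hε : 0 ≤ ε)
    (h0 : (2 + ε) * √(Fintype.card F) ≤ ‖trS F F ψ a‖) (k : ℕ) :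
    ∃ (L : Type) (_ : Field L) (_ : Fintype L) (_ : Algebra F L), Module.finrank F L = 2 ^ k ∧
      (2 + 4 ^ k * ε) * √(Fintype.card F) ^ (2 ^ k) ≤ ‖trS F L ψ a‖ := by
  classical
  induction k with
  | zero => exact ⟨F, inferInstance, inferInstance, inferInstance, by simp, by simpa using h0⟩
  | succ k ih =>
    obtain ⟨K, _, _, _, hfin, hb⟩ := ih
    have hK : ringChar K ≠ 2 := by
      rwa [← Algebra.ringChar_eq F K]
    obtain ⟨δ, hδ⟩ := FiniteField.exists_nonsquare hK
    have : Fact (∀ r : K, r ^ 2 ≠ δ + 0 * r) := ⟨fun r hr => hδ ⟨r, by rw [zero_mul, add_zero] at hr; rw [← hr, sq]⟩⟩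
    let _ : Fintype (QuadraticAlgebra K δ 0) := Fintype.ofEquiv _ (QuadraticAlgebra.equivProd δ 0).symm
    refine ⟨QuadraticAlgebra K δ 0, inferInstance, inferInstance, inferInstance, ?_, ?_⟩
    · rw [← Module.finrank_mul_finrank F K, hfin, QuadraticAlgebra.finrank_eq_two, pow_succ]
    · have hs := quad_step hK δ hδ _ (char_tr_primitive (K := K) ψ hψ) (algebraMap F K a)
        (by simpa using ha)
      have e1 : trS K (QuadraticAlgebra K δ 0) (ψ.compAddMonoidHom (Algebra.trace F K).toAddMonoidHom)
          (algebraMap F K a) = trS F (QuadraticAlgebra K δ 0) ψ a := by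
        unfold trS
        refine sum_congr rfl fun z _ => ?_
        split_ifs
        · rfl
        · rw [← Algebra.trace_trace (R := F) (S := K) (T := QuadraticAlgebra K δ 0), ← IsScalarTower.algebraMap_apply]
          rfl
      have e2 : trS K K (ψ.compAddMonoidHom (Algebra.trace F K).toAddMonoidHom)
          (algebraMap F K a) = trS F K ψ a := by
        unfold trS
        refine sum_congr rfl fun z _ => ?_
        split_ifs
        · rfl
        · simp
      have hcard : (Fintype.card K : ℝ) = √(Fintype.card F) ^ (2 ^ (k + 1)) := by
        rw [Module.card_eq_pow_finrank (K := F), hfin, pow_succ, mul_comm, pow_mul, Real.sq_sqrt (by positivity)]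
        push_cast; rfl
      rw [e1, e2] at hs
      have h4 : ‖trS F K ψ a‖ ^ 2 - 2 * Fintype.card K ≤ ‖trS F (QuadraticAlgebra K δ 0) ψ a‖ := by
        have h5 : trS F K ψ a ^ 2 = 2 * Fintype.card K - trS F (QuadraticAlgebra K δ 0) ψ a := by
          rw [← hs]; ring
        have h6 := norm_sub_le (2 * (Fintype.card K : ℂ)) (trS F (QuadraticAlgebra K δ 0) ψ a)
        rw [← h5, norm_pow] at h6
        simp only [norm_mul, Complex.norm_natCast, Complex.norm_ofNat] at h6
        linarith
      refine le_trans ?_ h4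
      rw [hcard]
      have hpos : 0 ≤ √(Fintype.card F : ℝ) ^ (2 ^ k) := by positivity
      have hx : √(Fintype.card F : ℝ) ^ (2 ^ (k + 1)) = (√(Fintype.card F : ℝ) ^ (2 ^ k)) ^ 2 := by
        rw [← pow_mul, pow_succ]
      rw [hx]
      have h7 : ((2 + 4 ^ k * ε) * √(Fintype.card F) ^ (2 ^ k)) ^ 2 ≤ ‖trS F K ψ a‖ ^ 2 :=
        pow_le_pow_left₀ (by positivity) hb 2
      have h8 : 0 ≤ (4 ^ k * ε) ^ 2 * (√(Fintype.card F : ℝ) ^ (2 ^ k)) ^ 2 := by positivity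
      rw [pow_succ]
      nlinarith

lemma trS_bound {F L : Type} [Field F] [Fintype F] [Field L] [Fintype L] [Algebra F L]
    (n : ℕ) (hn : Module.finrank F L = 2 * (n + 1)) (ψ : AddChar F ℂ) (hψ : ψ.IsPrimitive) (a : F) :
    ‖trS F L ψ a‖ ≤ 13 * Fintype.card F * (Fintype.card F : ℝ) ^ (n + 1) := by
  classical
  have hL : Fintype.card L = Fintype.card F ^ (2 * (n + 1)) := by
    rw [← hn]; exact Module.card_eq_pow_finrank
  have hN := fun c => stepanov (L := L) n hn a c
  have hcardF : 2 ≤ Fintype.card F := Fintype.one_lt_card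
  set q := Fintype.card F with hq
  let N : F → ℕ := fun c =>
    (univ.filter fun x : L => x ≠ 0 ∧ Algebra.trace F L (x + algebraMap F L a / x) = c).card
  have hsum : ∑ c, N c + 1 = q ^ (2 * (n + 1)) := by
    have h1 : ∑ c, N c = (univ.filter fun x : L => x ≠ 0).card := by
      rw [Finset.card_eq_sum_card_fiberwise (t := univ)
        (f := fun x => Algebra.trace F L (x + algebraMap F L a / x)) (by simp [Set.MapsTo])]
      simp only [N, filter_filter]
    rw [h1, filter_ne', card_erase_of_mem (mem_univ _), card_univ, hL]
    have : 0 < q ^ (2 * (n + 1)) := by positivity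
    omega
  have hS : trS F L ψ a = ∑ c, (N c : ℂ) * ψ c := by
    unfold trS
    rw [← Finset.sum_fiberwise_of_maps_to (s := univ) (t := univ)
      (g := fun x : L => Algebra.trace F L (x + algebraMap F L a / x)) (by simp)]
    refine sum_congr rfl fun c _ => ?_
    simp only [N]
    rw [← nsmul_eq_mul, ← sum_const, ← filter_filter, filter_comm, sum_filter (fun x : L => x ≠ 0)]
    refine sum_congr rfl fun x hx => ?_
    rw [(mem_filter.1 hx).2]
    by_cases h : x = 0 <;> simp [h]
  have hψ0 : ∑ c, ψ c = 0 := by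
    have := AddChar.sum_mulShift (1 : F) hψ
    simpa using this
  let A : ℝ := (q : ℝ) ^ (2 * n + 1)
  let r : ℝ := (q : ℝ) ^ (n + 1)
  have hS2 : trS F L ψ a = ∑ c, (((N c : ℝ) - A : ℝ) : ℂ) * ψ c := by
    have : ∑ c, (((N c : ℝ) - A : ℝ) : ℂ) * ψ c = ∑ c, (N c : ℂ) * ψ c - A * ∑ c, ψ c := by
      rw [mul_sum, ← sum_sub_distrib]
      refine sum_congr rfl fun c _ => ?_
      push_cast; ring
    rw [this, hψ0, hS]; simp
  rw [hS2]
  have hD : ∀ c, (N c : ℝ) - A ≤ 6 * r := by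
    intro c
    have : (N c : ℝ) ≤ q ^ (2 * n + 1) + 6 * q ^ (n + 1) := by exact_mod_cast hN c
    simp only [A, r]; linarith
  have hr : 0 ≤ r := by positivity
  have habs : ∀ c, |(N c : ℝ) - A| ≤ 12 * r - (N c - A) := by
    intro c
    have := hD c
    rw [abs_le]; constructor <;> linarith
  calc _ ≤ ∑ c, ‖(((N c : ℝ) - A : ℝ) : ℂ) * ψ c‖ := norm_sum_le _ _
    _ = ∑ c, |(N c : ℝ) - A| := by
      refine sum_congr rfl fun c _ => ?_
      rw [norm_mul, AddChar.norm_apply, mul_one, Complex.norm_real, Real.norm_eq_abs]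
    _ ≤ ∑ c, (12 * r - ((N c : ℝ) - A)) := sum_le_sum fun c _ => habs c
    _ = q * (12 * r) - (∑ c, (N c : ℝ)) + q * A := by
      simp only [sum_sub_distrib, sum_const, card_univ, nsmul_eq_mul, ← hq]; ring
    _ = 12 * q * r + 1 := by
      have h1 : (∑ c, (N c : ℝ)) + 1 = (q : ℝ) ^ (2 * (n + 1)) := by exact_mod_cast hsum
      have h2 : (q : ℝ) ^ (2 * (n + 1)) = q * A := by simp only [A]; ring
      linarith
    _ ≤ 13 * q * r := by
      have h1 : (1 : ℝ) ≤ q := by exact_mod_cast (by omega)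
      have h2 : (1 : ℝ) ≤ r := one_le_pow₀ h1
      nlinarith

theorem kloosterman_weil {F : Type} [Field F] [Fintype F] (hF : ringChar F ≠ 2) (ψ : AddChar F ℂ)
    (hψ : ψ.IsPrimitive) (a : F) (ha : a ≠ 0) :
    ‖trS F F ψ a‖ ≤ 2 * √(Fintype.card F) := by
  by_contra hcon
  push Not at hcon
  have hcardF : 2 ≤ Fintype.card F := Fintype.one_lt_card
  have hs : 0 < √(Fintype.card F : ℝ) := Real.sqrt_pos.2 (by positivity)
  set ε := ‖trS F F ψ a‖ / √(Fintype.card F) - 2 with hε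
  have hεpos : 0 < ε := by
    rw [hε, sub_pos, lt_div_iff₀ hs]; exact hcon
  have key := tower hF ψ hψ a ha ε hεpos.le (by
    rw [hε, add_sub_cancel, div_mul_cancel₀ _ hs.ne'])
  obtain ⟨k, hk⟩ := pow_unbounded_of_one_lt (13 * (Fintype.card F : ℝ) / ε) (by norm_num : (1 : ℝ) < 4)
  obtain ⟨L, _, _, _, hfin, hb⟩ := key (k + 1)
  have h2 : 2 ^ (k + 1) = 2 * ((2 ^ k - 1) + 1) := by
    have : 0 < 2 ^ k := by positivity
    rw [pow_succ]; omega
  have hub := trS_bound (2 ^ k - 1) (by rw [hfin, h2]) ψ hψ a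
  have h3 : √(Fintype.card F : ℝ) ^ (2 ^ (k + 1)) = (Fintype.card F : ℝ) ^ ((2 ^ k - 1) + 1) := by
    rw [h2, pow_mul, Real.sq_sqrt (by positivity)]
  rw [h3] at hb
  have h4 := le_of_mul_le_mul_right (hb.trans hub) (by positivity)
  rw [div_lt_iff₀ hεpos] at hk
  have h5 : (4 : ℝ) ^ k * ε ≤ 4 ^ (k + 1) * ε := by
    rw [pow_succ]; nlinarith [mul_pos (pow_pos (by norm_num : (0 : ℝ) < 4) k) hεpos]
  linarith

noncomputable def chi (F : Type) [Field F] [Fintype F] [DecidableEq F] : MulChar F ℂ :=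
  (quadraticChar F).ringHomComp (Int.castRingHom ℂ)

lemma chi_apply {F : Type} [Field F] [Fintype F] [DecidableEq F] (x : F) :
    chi F x = ((quadraticChar F x : ℤ) : ℂ) := rfl

lemma chi_zero {F : Type} [Field F] [Fintype F] [DecidableEq F] : chi F 0 = 0 :=
  MulChar.map_zero _

lemma chi_sq {F : Type} [Field F] [Fintype F] [DecidableEq F] (x : F) (hx : x ≠ 0) :
    chi F x * chi F x = 1 := by
  rw [chi_apply, ← Int.cast_mul, ← sq, quadraticChar_sq_one hx]; simp

lemma chi_norm {F : Type} [Field F] [Fintype F] [DecidableEq F] (x : F) (hx : x ≠ 0) :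
    ‖chi F x‖ = 1 := by
  have := congrArg norm (chi_sq x hx)
  rw [norm_mul, norm_one] at this
  nlinarith [norm_nonneg (chi F x)]

lemma gauss_norm {F : Type} [Field F] [Fintype F] [DecidableEq F] (hF : ringChar F ≠ 2)
    (ψ : AddChar F ℂ) (hψ : ψ.IsPrimitive) :
    ‖gaussSum (chi F) ψ‖ = √(Fintype.card F) := by
  have h1 : chi F ≠ 1 := by
    obtain ⟨a, ha⟩ := quadraticChar_exists_neg_one' hF
    intro h
    have h2 := congrArg (fun c : MulChar F ℂ => c a) h
    simp only [chi_apply, ha, MulChar.one_apply_coe] at h2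
    norm_num at h2
  have h2 := gaussSum_sq h1 ((quadraticChar_isQuadratic F).comp _) hψ
  have h3 := congrArg norm h2
  rw [norm_pow, norm_mul, chi_norm _ (by simp), one_mul, Complex.norm_natCast] at h3
  rw [← h3, Real.sqrt_sq (norm_nonneg _)]

lemma gauss_quad {F : Type} [Field F] [Fintype F] [DecidableEq F] (hF : ringChar F ≠ 2)
    (ψ : AddChar F ℂ) (hψ : ψ.IsPrimitive) (s : F) (hs : s ≠ 0) :
    ∑ x, ψ (s * x ^ 2) = chi F s * gaussSum (chi F) ψ := by
  rw [sum_sq_eq hF (fun D => ψ (s * D))]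
  simp only [← chi_apply, add_mul, one_mul, sum_add_distrib]
  have h1 : ∑ D, ψ (s * D) = 0 := by
    have := AddChar.sum_mulShift s hψ
    simpa [mul_comm, hs] using this
  rw [h1, add_zero, gaussSum, mul_sum,
    ← Equiv.sum_comp (Equiv.mulLeft₀ s hs) (fun x => chi F s * (chi F x * ψ x))]
  refine sum_congr rfl fun D _ => ?_
  simp only [Equiv.mulLeft₀_apply, map_mul]
  linear_combination (-(chi F D * ψ (s * D))) * chi_sq s hs

lemma gauss_quad_lin {F : Type} [Field F] [Fintype F] [DecidableEq F] (hF : ringChar F ≠ 2)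
    (ψ : AddChar F ℂ) (s m : F) (hs : s ≠ 0) :
    ∑ x, ψ (s * x ^ 2 + m * x) = ψ (-(m ^ 2) / (4 * s)) * ∑ x, ψ (s * x ^ 2) := by
  have h2 : (2 : F) ≠ 0 := Ring.two_ne_zero hF
  have h4 : (4 : F) ≠ 0 := by
    have : (4 : F) = 2 * 2 := by norm_num
    rw [this]; exact mul_ne_zero h2 h2
  rw [mul_sum, ← Equiv.sum_comp (Equiv.addRight (m / (2 * s))) (fun x => ψ (-(m ^ 2) / (4 * s)) * ψ (s * x ^ 2))]
  refine sum_congr rfl fun x _ => ?_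
  rw [← AddChar.map_add_eq_mul]
  congr 1
  simp only [Equiv.coe_addRight]
  have h4' : (4 : F) = 2 * 2 := by norm_num
  rw [h4']
  field_simp
  ring

lemma salie {F : Type} [Field F] [Fintype F] [DecidableEq F] (hF : ringChar F ≠ 2)
    (ψ : AddChar F ℂ) (hψ : ψ.IsPrimitive) (c : F) :
    ‖∑ x, chi F x * ψ (c * x + 1 / x)‖ ≤ 2 * √(Fintype.card F) := by
  have h2 : (2 : F) ≠ 0 := Ring.two_ne_zero hF
  have hq : 0 < √(Fintype.card F : ℝ) := Real.sqrt_pos.2 (by exact_mod_cast Fintype.card_pos)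
  set Γ := chi F (-1) * gaussSum (chi F) ψ with hΓ
  have hΓn : ‖Γ‖ = √(Fintype.card F) := by
    rw [hΓ, norm_mul, chi_norm _ (by simp), one_mul, gauss_norm hF ψ hψ]
  have hlin : ∑ y, ψ (-2 * y) = 0 := by
    have := AddChar.sum_mulShift (-2 : F) hψ
    rw [if_neg (by simpa using h2)] at this
    simpa [mul_comm] using this
  have key : Γ * ∑ x, chi F x * ψ (c * x + 1 / x)
      = Fintype.card F * ∑ y ∈ univ.filter (fun y : F => y ^ 2 = c), ψ (-2 * y) := by
    have h1 : ∀ x, Γ * (chi F x * ψ (c * x + 1 / x))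
        = ∑ y, (ψ (-2 * y) * ψ (x * (c - y ^ 2)) - if x = 0 then ψ (-2 * y) else 0) := by
      intro x
      by_cases hx : x = 0
      · subst hx; simp [chi_zero, hlin]
      · simp only [hx, if_false, sub_zero]
        have h3 : Γ * chi F x = ∑ y, ψ (-x * y ^ 2) := by
          rw [gauss_quad hF ψ hψ (-x) (by simpa using hx), hΓ, neg_eq_neg_one_mul x, map_mul]; ring
        rw [← mul_assoc, h3, sum_mul,
          ← Equiv.sum_comp (Equiv.addRight (1 / x)) (fun y => ψ (-x * y ^ 2) * ψ (c * x + 1 / x))]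
        refine sum_congr rfl fun y _ => ?_
        rw [← AddChar.map_add_eq_mul, ← AddChar.map_add_eq_mul]
        congr 1
        simp only [Equiv.coe_addRight]
        field_simp
        ring
    rw [mul_sum, sum_congr rfl fun x _ => h1 x, sum_comm]
    simp only [sum_sub_distrib, sum_ite_eq', mem_univ, if_true, sum_ite_irrel, sum_const_zero, hlin,
      sub_zero, ← mul_sum, AddChar.sum_mulShift _ hψ, sum_ite_eq]
    rw [mul_sum, sum_filter]
    refine sum_congr rfl fun y _ => ?_
    by_cases h : y ^ 2 = c
    · simp [h, mul_comm]
    · simp [h, sub_eq_zero, Ne.symm h]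
  have hcard : (univ.filter (fun y : F => y ^ 2 = c)).card ≤ 2 := by
    have h3 := quadraticChar_card_sqrts hF c
    rw [Set.toFinset_ofPred] at h3
    have h4 : quadraticChar F c ≤ 1 := by
      rcases quadraticChar_isQuadratic F c with h | h | h <;> rw [h] <;> norm_num
    have : ((univ.filter (fun y : F => y ^ 2 = c)).card : ℤ) ≤ 2 := by rw [h3]; linarith
    exact_mod_cast this
  have hn := congrArg norm key
  rw [norm_mul Γ, hΓn, norm_mul, Complex.norm_natCast] at hn
  have hb : ‖∑ y ∈ univ.filter (fun y : F => y ^ 2 = c), ψ (-2 * y)‖ ≤ 2 := by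
    refine (norm_sum_le _ _).trans ?_
    simp only [AddChar.norm_apply, sum_const, nsmul_eq_mul, mul_one]
    exact_mod_cast hcard
  have hqq : (Fintype.card F : ℝ) = √(Fintype.card F) * √(Fintype.card F) :=
    (Real.mul_self_sqrt (by positivity)).symm
  refine le_of_mul_le_mul_left ?_ hq
  rw [hn]
  nth_rewrite 1 [hqq]
  nlinarith

lemma hhat_bound {F : Type} [Field F] [Fintype F] [DecidableEq F] (hF : ringChar F ≠ 2)
    (ψ : AddChar F ℂ) (hψ : ψ.IsPrimitive) (t : F) (ht : t ≠ 0) (b : F) (d : ℕ) :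
    ‖∑ s, if s = 0 then 0 else ψ (-(s * t) - b / s) * (∑ x, ψ (s * x ^ 2)) ^ d‖
      ≤ 2 * √(Fintype.card F) * √(Fintype.card F) ^ d := by
  have hq1 : 1 ≤ √(Fintype.card F : ℝ) := by
    rw [Real.one_le_sqrt]; exact_mod_cast Fintype.card_pos
  have hn0 : ∀ S : ℂ, ‖S‖ ≤ 2 * √(Fintype.card F) → ‖S * gaussSum (chi F) ψ ^ d‖ ≤
      2 * √(Fintype.card F) * √(Fintype.card F) ^ d := by
    intro S hS
    rw [norm_mul, norm_pow, gauss_norm hF ψ hψ]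
    gcongr
  rcases Nat.even_or_odd d with hd | hd
  · have h1 : (∑ s, if s = 0 then 0 else ψ (-(s * t) - b / s) * (∑ x, ψ (s * x ^ 2)) ^ d)
        = (∑ s, if s = 0 then 0 else ψ (-(s * t) - b / s)) * gaussSum (chi F) ψ ^ d := by
      rw [sum_mul]
      refine sum_congr rfl fun s _ => ?_
      split_ifs with hs
      · simp
      · rw [gauss_quad hF ψ hψ s hs, mul_pow]
        obtain ⟨k, rfl⟩ := hd
        rw [pow_add (chi F s), ← mul_pow, chi_sq s hs]; simp
    rw [h1]
    apply hn0
    by_cases hb : b = 0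
    · have h2 : (∑ s, if s = 0 then 0 else ψ (-(s * t) - b / s)) = -1 := by
        have h3 : ∀ s, (if s = 0 then 0 else ψ (-(s * t) - b / s)) = ψ (s * (-t)) - if s = 0 then 1 else 0 := by
          intro s
          split_ifs with hs
          · simp [hs]
          · simp [hb]
        rw [sum_congr rfl fun s _ => h3 s, sum_sub_distrib, AddChar.sum_mulShift _ hψ]
        simp [ht]
      rw [h2]; simp; linarith
    · have h2 := kloosterman_weil hF ψ hψ (t * b) (mul_ne_zero ht hb)
      convert h2 using 2
      unfold trS
      conv_rhs => rw [← Equiv.sum_comp (Equiv.mulLeft₀ (-t) (by simpa using ht))]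
      refine sum_congr rfl fun s _ => ?_
      by_cases hs : s = 0
      · simp [hs]
      · have : -t * s ≠ 0 := mul_ne_zero (by simpa using ht) hs
        simp only [Equiv.mulLeft₀_apply, hs, this, if_false, Algebra.trace_self, LinearMap.id_apply,
          Algebra.algebraMap_self_apply]
        congr 1
        field_simp
        ring
  · have h1 : (∑ s, if s = 0 then 0 else ψ (-(s * t) - b / s) * (∑ x, ψ (s * x ^ 2)) ^ d)
        = (∑ s, chi F s * ψ (-(s * t) - b / s)) * gaussSum (chi F) ψ ^ d := by
      rw [sum_mul]
      refine sum_congr rfl fun s _ => ?_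
      split_ifs with hs
      · simp [hs, chi_zero]
      · rw [gauss_quad hF ψ hψ s hs, mul_pow]
        obtain ⟨k, rfl⟩ := hd
        have : chi F s ^ (2 * k + 1) = chi F s := by
          rw [pow_succ, pow_mul, sq, chi_sq s hs]; simp
        rw [this]; ring
    rw [h1]
    apply hn0
    have h2 := salie hF ψ hψ (b * t)
    have h3 : ∑ s, chi F s * ψ (-(s * t) - b / s)
        = chi F (-t) * ∑ x, chi F x * ψ (b * t * x + 1 / x) := by
      have hu : (-t)⁻¹ ≠ 0 := inv_ne_zero (by simpa using ht)
      have hinv : Function.Involutive (fun x : F => (-t)⁻¹ * x⁻¹) := by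
        intro x
        by_cases hx : x = 0
        · simp [hx]
        · field_simp
      let e : F ≃ F := hinv.toPerm
      have he : ∀ x, e x = (-t)⁻¹ * x⁻¹ := fun x => rfl
      rw [mul_sum, ← Equiv.sum_comp e
        (fun s => chi F s * ψ (-(s * t) - b / s))]
      refine sum_congr rfl fun x _ => ?_
      by_cases hx : x = 0
      · simp [e, hx, chi_zero]
      have hchi : ∀ y : F, y ≠ 0 → chi F y⁻¹ = chi F y := by
        intro y hy
        have h5 := chi_sq y hy
        have h6 : chi F y⁻¹ * chi F y = 1 := by rw [← map_mul, inv_mul_cancel₀ hy, map_one]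
        have h7 : chi F y ≠ 0 := fun h => by simp [h] at h5
        exact mul_right_cancel₀ h7 (h6.trans h5.symm)
      simp only [he, map_mul]
      rw [hchi _ hx, hchi _ (by simpa using ht), mul_assoc]
      congr 3
      field_simp
      ring
    rw [h3, norm_mul, chi_norm _ (by simpa using ht), one_mul]
    exact h2

lemma psi_sum {F : Type} [Field F] (ψ : AddChar F ℂ) {ι : Type} (S : Finset ι) (f : ι → F) :
    ψ (∑ i ∈ S, f i) = ∏ i ∈ S, ψ (f i) := by
  classical
  induction S using Finset.induction_on with
  | empty => simp
  | insert a S ha ih => rw [sum_insert ha, prod_insert ha, AddChar.map_add_eq_mul, ih]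

lemma orth {F : Type} [Field F] [Fintype F] [DecidableEq F]
    (ψ : AddChar F ℂ) (hψ : ψ.IsPrimitive) {d : ℕ} (w : Fin d → F) :
    ∑ m : Fin d → F, ψ (∑ j, m j * w j) = if w = 0 then (Fintype.card F : ℂ) ^ d else 0 := by
  simp only [psi_sum]
  rw [← Fintype.prod_sum (fun j x => ψ (x * w j))]
  simp only [AddChar.sum_mulShift _ hψ]
  split_ifs with h
  · simp [h]
  · obtain ⟨j, hj⟩ := Function.ne_iff.1 h
    exact prod_eq_zero (mem_univ j) (by simpa using hj)

lemma Hhat_eq {F : Type} [Field F] [Fintype F] [DecidableEq F] (hF : ringChar F ≠ 2)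
    (ψ : AddChar F ℂ) (t : F) {d : ℕ} (m : Fin d → F) :
    ∑ z : Fin d → F, (∑ s, if s = 0 then 0 else ψ (s * (∑ j, z j ^ 2 - t))) * ψ (∑ j, m j * z j)
     = ∑ s, if s = 0 then 0 else
        ψ (-(s * t) - ((∑ j, m j ^ 2) / 4) / s) * (∑ x, ψ (s * x ^ 2)) ^ d := by
  simp only [sum_mul]
  rw [sum_comm]
  refine sum_congr rfl fun s _ => ?_
  split_ifs with hs
  · simp
  have h2 : (2 : F) ≠ 0 := Ring.two_ne_zero hF
  have h4' : (4 : F) = 2 * 2 := by norm_num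
  have h1 : ∀ z : Fin d → F, ψ (s * (∑ j, z j ^ 2 - t)) * ψ (∑ j, m j * z j)
      = ψ (-(s * t)) * ∏ j, ψ (s * z j ^ 2 + m j * z j) := by
    intro z
    rw [← psi_sum, ← AddChar.map_add_eq_mul, ← AddChar.map_add_eq_mul, sum_add_distrib, ← mul_sum]
    congr 1; ring
  rw [sum_congr rfl fun z _ => h1 z, ← mul_sum,
    ← Fintype.prod_sum (fun j x => ψ (s * x ^ 2 + m j * x))]
  simp only [gauss_quad_lin hF ψ s _ hs]
  rw [prod_mul_distrib, ← psi_sum, ← mul_assoc, ← AddChar.map_add_eq_mul, prod_const, card_univ,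
    Fintype.card_fin, ← sum_div, sum_neg_distrib]
  congr 2
  rw [h4']
  field_simp
  ring

lemma A_sq {F : Type} [Field F] [Fintype F] [DecidableEq F]
    (ψ : AddChar F ℂ) {d : ℕ} (E : Finset (Fin d → F)) (m : Fin d → F) :
    (∑ x ∈ E, ψ (∑ j, m j * (-x j))) * (∑ y ∈ E, ψ (∑ j, m j * y j))
      = ((‖∑ y ∈ E, ψ (∑ j, m j * y j)‖ ^ 2 : ℝ) : ℂ) := by
  have h : (∑ x ∈ E, ψ (∑ j, m j * (-x j)))
      = (starRingEnd ℂ) (∑ y ∈ E, ψ (∑ j, m j * y j)) := by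
    rw [map_sum]
    refine sum_congr rfl fun x _ => ?_
    rw [← AddChar.map_neg_eq_conj]
    congr 1
    simp
  rw [h, Complex.conj_mul']
  push_cast
  rfl

lemma A_sum {F : Type} [Field F] [Fintype F] [DecidableEq F]
    (ψ : AddChar F ℂ) (hψ : ψ.IsPrimitive) {d : ℕ} (E : Finset (Fin d → F)) :
    ∑ m : Fin d → F, ‖∑ y ∈ E, ψ (∑ j, m j * y j)‖ ^ 2 = (Fintype.card F : ℝ) ^ d * E.card := by
  have h : (∑ m : Fin d → F, ((‖∑ y ∈ E, ψ (∑ j, m j * y j)‖ ^ 2 : ℝ) : ℂ))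
      = (Fintype.card F : ℂ) ^ d * E.card := by
    simp only [← A_sq, sum_mul_sum]
    rw [sum_comm]
    have h1 : ∀ x ∈ E, ∑ m : Fin d → F, ∑ y ∈ E, ψ (∑ j, m j * (-x j)) * ψ (∑ j, m j * y j)
        = (Fintype.card F : ℂ) ^ d := by
      intro x hx
      rw [sum_comm]
      have h2 : ∀ y ∈ E, ∑ m : Fin d → F, ψ (∑ j, m j * (-x j)) * ψ (∑ j, m j * y j)
          = if y = x then (Fintype.card F : ℂ) ^ d else 0 := by
        intro y _
        have := orth ψ hψ (y - x)
        simp only [sub_eq_zero] at this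
        rw [← this]
        refine sum_congr rfl fun m _ => ?_
        rw [← AddChar.map_add_eq_mul, ← sum_add_distrib]
        congr 1
        refine sum_congr rfl fun j _ => ?_
        simp only [Pi.sub_apply]; ring
      rw [sum_congr rfl h2, sum_ite_eq', if_pos hx]
    rw [sum_congr rfl h1, sum_const, nsmul_eq_mul, mul_comm]
  exact_mod_cast h

lemma parseval {F : Type} [Field F] [Fintype F] [DecidableEq F]
    (ψ : AddChar F ℂ) (hψ : ψ.IsPrimitive) {d : ℕ} (E : Finset (Fin d → F))
    (H : (Fin d → F) → ℂ) :
    (Fintype.card F : ℂ) ^ d * ∑ x ∈ E, ∑ y ∈ E, H (x - y)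
      = ∑ m : Fin d → F, (∑ z, H z * ψ (∑ j, m j * z j)) *
        ((‖∑ y ∈ E, ψ (∑ j, m j * y j)‖ ^ 2 : ℝ) : ℂ) := by
  have hA : ∀ m : Fin d → F, ((‖∑ y ∈ E, ψ (∑ j, m j * y j)‖ ^ 2 : ℝ) : ℂ)
      = ∑ x ∈ E, ∑ y ∈ E, ψ (∑ j, m j * (-x j)) * ψ (∑ j, m j * y j) := by
    intro m
    rw [← A_sq, sum_mul_sum]
  simp only [hA]
  simp only [mul_sum _ _ (∑ z, H z * ψ _), mul_sum E _ (_ ^ d)]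
  conv_rhs => rw [sum_comm]
  refine sum_congr rfl fun x _ => ?_
  conv_rhs => rw [sum_comm]
  refine sum_congr rfl fun y _ => ?_
  simp only [sum_mul]
  rw [sum_comm]
  have h2 : ∀ z : Fin d → F, ∑ m : Fin d → F, H z * ψ (∑ j, m j * z j) *
      (ψ (∑ j, m j * (-x j)) * ψ (∑ j, m j * y j))
      = if z = x - y then (Fintype.card F : ℂ) ^ d * H z else 0 := by
    intro z
    have := orth ψ hψ (z - (x - y))
    simp only [sub_eq_zero] at this
    have h3 : (if z = x - y then (Fintype.card F : ℂ) ^ d * H z else 0)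
      = H z * (if z = x - y then (Fintype.card F : ℂ) ^ d else 0) := by
        split_ifs <;> ring
    rw [h3, ← this, mul_sum]
    refine sum_congr rfl fun m _ => ?_
    rw [mul_assoc, ← AddChar.map_add_eq_mul, ← AddChar.map_add_eq_mul,
      ← sum_add_distrib, ← sum_add_distrib]
    congr 2
    refine sum_congr rfl fun j _ => ?_
    simp only [Pi.sub_apply]; ring
  rw [sum_congr rfl fun z _ => h2 z, sum_ite_eq', if_pos (mem_univ _)]

lemma main_bound {F : Type} [Field F] [Fintype F] [DecidableEq F] (hF : ringChar F ≠ 2)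
    (ψ : AddChar F ℂ) (hψ : ψ.IsPrimitive) {d : ℕ} (E : Finset (Fin d → F)) (t : F) (ht : t ≠ 0) :
    ‖∑ x ∈ E, ∑ y ∈ E, ∑ s, (if s = 0 then 0 else ψ (s * (∑ j, (x - y) j ^ 2 - t)))‖
      ≤ 2 * √(Fintype.card F) * √(Fintype.card F) ^ d * E.card := by
  have h := congrArg norm (parseval ψ hψ E
    (fun z => ∑ s, if s = 0 then 0 else ψ (s * (∑ j, z j ^ 2 - t))))
  simp only [Hhat_eq hF] at h
  rw [norm_mul, norm_pow, Complex.norm_natCast] at h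
  have hq : 0 < (Fintype.card F : ℝ) ^ d := pow_pos (by exact_mod_cast Fintype.card_pos) _
  refine le_of_mul_le_mul_left ?_ hq
  rw [h]
  refine (norm_sum_le _ _).trans ?_
  have h2 : ∀ m ∈ (univ : Finset (Fin d → F)), ‖(∑ s, if s = 0 then 0 else
        ψ (-(s * t) - ((∑ j, m j ^ 2) / 4) / s) * (∑ x, ψ (s * x ^ 2)) ^ d) *
        ((‖∑ y ∈ E, ψ (∑ j, m j * y j)‖ ^ 2 : ℝ) : ℂ)‖
      ≤ 2 * √(Fintype.card F) * √(Fintype.card F) ^ d * ‖∑ y ∈ E, ψ (∑ j, m j * y j)‖ ^ 2 := by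
    intro m _
    rw [norm_mul, Complex.norm_real, Real.norm_of_nonneg (by positivity)]
    gcongr
    exact hhat_bound hF ψ hψ t ht _ d
  refine (sum_le_sum h2).trans ?_
  rw [← mul_sum, A_sum ψ hψ E]
  apply le_of_eq
  ring

lemma count_eq {F : Type} [Field F] [Fintype F] [DecidableEq F]
    (ψ : AddChar F ℂ) (hψ : ψ.IsPrimitive) {d : ℕ} (E : Finset (Fin d → F)) (t : F) :
    (Fintype.card F : ℂ) * (((E ×ˢ E).filter (fun p : (Fin d → F) × (Fin d → F) =>
          ∑ j, (p.1 j - p.2 j) ^ 2 = t)).card : ℂ) = (E.card : ℂ) ^ 2 +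
      ∑ x ∈ E, ∑ y ∈ E, ∑ s, (if s = 0 then 0 else ψ (s * (∑ j, (x - y) j ^ 2 - t))) := by
  have h1 : ∀ u : F, (∑ s, if s = 0 then 0 else ψ (s * u))
      = (if u = 0 then (Fintype.card F : ℂ) else 0) - 1 := by
    intro u
    have h3 : ∀ s, (if s = 0 then 0 else ψ (s * u)) = ψ (s * u) - if s = 0 then 1 else 0 := by
      intro s
      split_ifs with hs
      · simp [hs]
      · simp
    rw [sum_congr rfl fun s _ => h3 s, sum_sub_distrib, AddChar.sum_mulShift _ hψ]
    simp
  simp only [h1, sum_sub_distrib, sum_const, nsmul_eq_mul, mul_one, sub_eq_zero (b := t), Pi.sub_apply]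
  rw [← sum_product' E E (fun x y => if ∑ j, (x j - y j) ^ 2 = t then (Fintype.card F : ℂ) else 0),
    ← sum_filter, sum_const, nsmul_eq_mul]
  ring

theorem main_thm {F : Type} [Field F] [Fintype F] [DecidableEq F]
    (q : ℕ) (hq : Fintype.card F = q) (hodd : Odd q)
    (d : ℕ)
    (E : Finset (Fin d → F))
    (t : F) (ht : t ≠ 0) (N : ℕ)
    (hN : N = ((E ×ˢ E).filter (fun p : (Fin d → F) × (Fin d → F) =>
          ∑ j, (p.1 j - p.2 j) ^ 2 = t)).card) :
    ∃ R : ℝ, (N : ℝ) = (E.card : ℝ) ^ 2 / (q : ℝ) + R ∧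
        |R| ≤ 2 * (q : ℝ) ^ (((d : ℝ) - 1) / 2) * (E.card : ℝ) := by
  have hF : ringChar F ≠ 2 := by
    intro h
    have h2 := FiniteField.even_card_of_char_two h
    rw [hq] at h2
    rcases hodd with ⟨k, rfl⟩
    omega
  have hψ := AddChar.FiniteField.primitiveChar_to_Complex_isPrimitive F
  have hb := main_bound hF _ hψ E t ht
  have hc := count_eq _ hψ E t
  rw [← hN, hq] at hc
  rw [hq] at hb
  have hq0 : 0 < (q : ℝ) := by rw [← hq]; exact_mod_cast Fintype.card_pos
  refine ⟨N - (E.card : ℝ) ^ 2 / q, by ring, ?_⟩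
  rw [eq_sub_iff_add_eq'.2 hc.symm] at hb
  have h5 : ((q : ℂ) * N - (E.card : ℂ) ^ 2) = ((q * (N - (E.card : ℝ) ^ 2 / q) : ℝ) : ℂ) := by
    have : (q : ℝ) * (N - (E.card : ℝ) ^ 2 / q) = q * N - (E.card : ℝ) ^ 2 := by field_simp
    rw [this]; push_cast; ring
  rw [h5, Complex.norm_real, Real.norm_eq_abs, abs_mul, abs_of_pos hq0] at hb
  refine le_of_mul_le_mul_left (hb.trans (le_of_eq ?_)) hq0
  have h6 : (q : ℝ) * (q : ℝ) ^ (((d : ℝ) - 1) / 2) = √q * √q ^ d := by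
    rw [← pow_succ', Real.sqrt_eq_rpow, ← Real.rpow_natCast, ← Real.rpow_mul hq0.le]
    nth_rewrite 1 [← Real.rpow_one (q : ℝ)]
    rw [← Real.rpow_add hq0]
    congr 1
    push_cast
    ring
  linear_combination (-2 * (E.card : ℝ)) * h6

end FalcHelp


theorem statement16 {F : Type} [Field F] [Fintype F] [DecidableEq F]
    (q : ℕ) (hq : Fintype.card F = q) (hodd : Odd q)
    (d : ℕ) (hd : 2 ≤ d)
    (E : Finset (Fin d → F))
    (t : F) (ht : t ≠ 0) :
    ∃ R : ℝ,
      (((E ×ˢ E).filter (fun p : (Fin d → F) × (Fin d → F) =>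
          ∑ j, (p.1 j - p.2 j) ^ 2 = t)).card : ℝ) = (E.card : ℝ) ^ 2 / (q : ℝ) + R ∧
        |R| ≤ 2 * (q : ℝ) ^ (((d : ℝ) - 1) / 2) * (E.card : ℝ) := by
  exact FalcHelp.main_thm q hq hodd d E t ht _ rfl
end

section
/- Let q be an odd prime power, d ≥ 2, and E ⊆ 𝔽_q^d with |E| > 4·q^{(d+1)/2}. Then |{(x,y) ∈ E × E : ‖x−y‖ = 1}| ≥ |E|^2/(2q); that is, the number of edges in the unit-distance graph of E is at least |E|^2/(2q). -/
section Stepanov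
open Polynomial
variable {L : Type} [Field L]

noncomputable def stRho (p : ℕ) (a b : L) (s : ℕ) : L[X] :=
  if s < p then X ^ (p + s) else X ^ (s + 1) + (C a * X ^ (2 * p) + C b) * X ^ (s - p)

noncomputable def stTheta (p R : ℕ) (a b : L) (τ : L[X]) (l j : ℕ) : L[X] :=
  ∑ t ∈ Finset.range (l + 1), (l.choose t : L[X]) *
    (expand L p (τ ^ (l - t) * X ^ (R * (p - 1 - (l - t)))) * stRho p a b (t + j))

noncomputable def stEv {Ω : Type} [Field Ω] [Algebra L Ω] (p : ℕ) (x z : Ω) : L[X] →ₗ[L] Ω :=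
  Polynomial.lsum (fun n => LinearMap.toSpanSingleton L Ω (x ^ (n / p) * z ^ (n % p)))

variable {Ω : Type} [Field Ω] [Algebra L Ω]

lemma stEv_monomial (p : ℕ) (x z : Ω) (n : ℕ) (c : L) :
    stEv p x z (monomial n c) = algebraMap L Ω c * (x ^ (n / p) * z ^ (n % p)) := by
  simp [stEv, Algebra.smul_def]

lemma stEv_X_pow (p : ℕ) (x z : Ω) (n : ℕ) :
    stEv (L := L) p x z (X ^ n) = (x ^ (n / p) * z ^ (n % p)) := by
  rw [X_pow_eq_monomial, stEv_monomial]; simp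

lemma stEv_expand_mul (p : ℕ) (hp : 0 < p) (x z : Ω) (g y : L[X]) :
    stEv p x z (expand L p g * y) = aeval x g * stEv p x z y := by
  induction g using Polynomial.induction_on' with
  | add g h hg hh => simp only [map_add, add_mul, hg, hh]
  | monomial e c =>
    induction y using Polynomial.induction_on' with
    | add g h hg hh => simp only [map_add, mul_add, hg, hh]
    | monomial n d =>
      rw [expand_monomial, monomial_mul_monomial, stEv_monomial, stEv_monomial, aeval_monomial,
        map_mul]
      have h1 : (e * p + n) / p = e + n / p := by
        rw [mul_comm, Nat.mul_add_div hp]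
      have h2 : (e * p + n) % p = n % p := by
        rw [mul_comm, Nat.mul_add_mod]
      rw [h1, h2, pow_add]; ring

lemma stEv_rho (p : ℕ) (hp : 2 ≤ p) (a b : L) (x z : Ω)
    (h : x * (z ^ p - z) = algebraMap L Ω a * x ^ 2 + algebraMap L Ω b) (s : ℕ) (hs : s ≤ 2 * p - 2) :
    stEv p x z (stRho p a b s) = x * z ^ s := by
  unfold stRho
  split_ifs with hsp
  · rw [stEv_X_pow, Nat.add_div_left _ (by omega), Nat.add_mod_left, Nat.div_eq_of_lt hsp,
      Nat.mod_eq_of_lt hsp]; simp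
  · obtain ⟨e, rfl⟩ : ∃ e, s = p + e := ⟨s - p, by omega⟩
    have he : e + 1 < p := by omega
    have e1 : (C a * X ^ (2 * p) + C b : L[X]) * X ^ (p + e - p) =
        monomial (p * 2 + e) a + monomial e b := by
      rw [← C_mul_X_pow_eq_monomial, ← C_mul_X_pow_eq_monomial]
      simp only [Nat.add_sub_cancel_left]; ring
    rw [map_add, stEv_X_pow, e1, map_add, stEv_monomial, stEv_monomial]
    have h1 : (p + e + 1) / p = 1 := by
      rw [add_assoc, Nat.add_div_left _ (by omega), Nat.div_eq_of_lt he]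
    have h2 : (p + e + 1) % p = e + 1 := by
      rw [add_assoc, Nat.add_mod_left, Nat.mod_eq_of_lt he]
    have h3 : (p * 2 + e) / p = 2 := by
      rw [Nat.mul_add_div (by omega), Nat.div_eq_of_lt (by omega)]
    have h4 : (p * 2 + e) % p = e := by
      rw [Nat.mul_add_mod, Nat.mod_eq_of_lt (by omega)]
    have h5 : e / p = 0 := Nat.div_eq_of_lt (by omega)
    have h6 : e % p = e := Nat.mod_eq_of_lt (by omega)
    rw [h1, h2, h3, h4, h5, h6, pow_add, pow_add]
    linear_combination (-z ^ e) * h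

lemma stEv_theta (p R : ℕ) (hp : 2 ≤ p) (a b : L) (τ : L[X]) (x z T : Ω)
    (h : x * (z ^ p - z) = algebraMap L Ω a * x ^ 2 + algebraMap L Ω b)
    (hT : aeval x τ = x ^ R * T) (l j : ℕ) (hl : l < p) (hj : j < p) :
    stEv p x z (stTheta p R a b τ l j) = x ^ (R * (p - 1) + 1) * z ^ j * (z + T) ^ l := by
  unfold stTheta
  rw [map_sum, add_pow, Finset.mul_sum]
  refine Finset.sum_congr rfl fun t ht => ?_
  have htl : t ≤ l := by simpa [Nat.lt_succ_iff] using ht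
  rw [← nsmul_eq_mul, map_nsmul, stEv_expand_mul p (by omega), stEv_rho p hp a b x z h _ (by omega), nsmul_eq_mul,
    map_mul, map_pow, map_pow, hT, aeval_X, mul_pow, ← pow_mul]
  have : R * (p - 1) + 1 = R * (l - t) + R * (p - 1 - (l - t)) + 1 := by
    rw [← mul_add]; congr 2; omega
  rw [this]; ring

lemma stRho_natDegree_le (p : ℕ) (hp : 1 ≤ p) (a b : L) (s : ℕ) :
    (stRho p a b s).natDegree ≤ p + s := by
  unfold stRho
  split_ifs with h
  · simp
  · have e1 : (C a * X ^ (2 * p) + C b : L[X]) * X ^ (s - p) =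
        C a * X ^ (2 * p + (s - p)) + C b * X ^ (s - p) := by ring
    rw [e1]
    refine (natDegree_add_le _ _).trans (max_le ?_ ((natDegree_add_le _ _).trans (max_le ?_ ?_)))
    · simp; omega
    · exact (natDegree_C_mul_X_pow_le _ _).trans (by omega)
    · exact (natDegree_C_mul_X_pow_le _ _).trans (by omega)

lemma stTheta_natDegree (p R : ℕ) (hp : 2 ≤ p) (hR : 1 ≤ R) (a b : L) (τ : L[X])
    (hτ : τ.natDegree = 2 * R) (l j : ℕ) (hl : l < p) (hj : j < p) :
    stTheta p R a b τ l j ≠ 0 ∧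
    (stTheta p R a b τ l j).natDegree = p * (R * (p - 1 + l) + 1) + j := by
  have hτ0 : τ ≠ 0 := by rintro rfl; simp at hτ; omega
  have key : (stTheta p R a b τ l j).natDegree = p * (R * (p - 1 + l) + 1) + j := by
    unfold stTheta
    rw [Finset.sum_range_succ']
    have h0 : (((l.choose 0 : ℕ) : L[X]) *
      (expand L p (τ ^ (l - 0) * X ^ (R * (p - 1 - (l - 0)))) * stRho p a b (0 + j))).natDegree
        = p * (R * (p - 1 + l) + 1) + j := by
      simp only [Nat.choose_zero_right, Nat.cast_one, one_mul, Nat.sub_zero, zero_add, stRho, hj,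
        if_true]
      rw [natDegree_mul, natDegree_expand, natDegree_mul, natDegree_pow, natDegree_X_pow,
        natDegree_X_pow, hτ]
      · obtain ⟨m, hm⟩ : ∃ m, p - 1 = l + m := ⟨p - 1 - l, by omega⟩
        rw [hm, Nat.add_sub_cancel_left]; ring
      · exact pow_ne_zero _ hτ0
      · exact pow_ne_zero _ X_ne_zero
      · rw [Ne, expand_eq_zero (by omega)]
        exact mul_ne_zero (pow_ne_zero _ hτ0) (pow_ne_zero _ X_ne_zero)
      · exact pow_ne_zero _ X_ne_zero
    rw [natDegree_add_eq_right_of_natDegree_lt, h0]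
    rw [h0]
    refine lt_of_le_of_lt (natDegree_sum_le_of_forall_le (n := p * (R * (p - 1 + l) + 1) + j - 1) _ _ ?_) ?_
    · intro t ht
      have htl : t < l := by simpa using ht
      rw [← nsmul_eq_mul]
      refine (natDegree_smul_le _ _).trans ?_
      refine natDegree_mul_le.trans ?_
      have h1 := stRho_natDegree_le p (by omega) a b (t + 1 + j)
      rw [natDegree_expand, natDegree_mul (pow_ne_zero _ hτ0) (pow_ne_zero _ X_ne_zero),
        natDegree_pow, natDegree_X_pow, hτ]
      obtain ⟨u, hu⟩ : ∃ u, l = t + 1 + u := ⟨l - (t + 1), by omega⟩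
      obtain ⟨m, hm⟩ : ∃ m, p - 1 = l + m := ⟨p - 1 - l, by omega⟩
      have e1 : l - (t + 1) = u := by omega
      have e2 : p - 1 - u = t + 1 + m := by omega
      rw [e1, e2]
      have e3 : p * (R * (p - 1 + l) + 1) + j = (u * (2 * R) + R * (t + 1 + m)) * p + p + j
          + R * p * (t + 1) := by
        rw [hm, hu]; ring
      rw [e3]
      have e4 : 2 * (t + 1) ≤ R * p * (t + 1) := by
        have : 1 * 2 ≤ R * p := Nat.mul_le_mul hR hp
        exact Nat.mul_le_mul_right _ (by omega)
      omega
    · have : 0 < p * (R * (p - 1 + l) + 1) := by positivity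
      omega
  refine ⟨fun h => ?_, key⟩
  rw [h] at key
  have : 0 < p * (R * (p - 1 + l) + 1) := by positivity
  simp at key; omega

lemma st_sum_ne_zero {ι : Type} [Fintype ι] (f : ι → L[X]) (hf : ∀ i, f i ≠ 0)
    (hinj : Function.Injective fun i => (f i).natDegree) (γ : ι → L) (hγ : γ ≠ 0) :
    ∑ i, γ i • f i ≠ 0 := by
  classical
  obtain ⟨i0, hi0⟩ := Function.ne_iff.mp hγ
  obtain ⟨m, hm, hmax⟩ := Finset.exists_max_image (Finset.univ.filter fun i => γ i ≠ 0)
    (fun i => (f i).natDegree) ⟨i0, by simpa using hi0⟩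
  intro h
  have h1 := congrArg (fun g => coeff g (f m).natDegree) h
  simp only [finsetSum_coeff, coeff_smul, coeff_zero] at h1
  rw [Finset.sum_eq_single m] at h1
  · have : γ m ≠ 0 := by simpa using hm
    have h2 : (f m).leadingCoeff ≠ 0 := by simpa using hf m
    simp only [smul_eq_mul, coeff_natDegree] at h1
    exact mul_ne_zero this h2 h1
  · intro i _ him
    by_cases hi : γ i = 0
    · simp [hi]
    · have h3 := hmax i (by simpa using hi)
      have h4 : (f i).natDegree ≠ (f m).natDegree := fun e => him (hinj e)
      rw [coeff_eq_zero_of_natDegree_lt (lt_of_le_of_ne h3 h4), smul_zero]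
  · simp

lemma st_count (p : ℕ) (hp : p.Prime) [CharP Ω p] (G : L[X]) (hG : G ≠ 0) (A : Finset L)
    (hA : ∀ x ∈ A, ∃ z : Ω, ∀ t : ℕ, stEv p (algebraMap L Ω x) (z + t) G = 0) :
    A.card ≤ G.natDegree / p := by
  classical
  have hp0 := hp.pos
  let g : ℕ → L[X] := fun m => ∑ e ∈ Finset.range (G.natDegree / p + 1), monomial e (G.coeff (p * e + m))
  have hev : ∀ x z : Ω, stEv p x z G = ∑ m ∈ Finset.range p, aeval x (g m) * z ^ m := by
    intro x z
    have h1 : G = ∑ n ∈ Finset.range (p * (G.natDegree / p + 1)), monomial n (G.coeff n) := by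
      conv_lhs => rw [G.as_sum_range' _ (Nat.lt_mul_div_succ G.natDegree hp0)]
    have h2 : stEv p x z G = ∑ n ∈ Finset.range (p * (G.natDegree / p + 1)),
        algebraMap L Ω (G.coeff n) * (x ^ (n / p) * z ^ (n % p)) := by
      conv_lhs => rw [h1]
      rw [map_sum]; exact Finset.sum_congr rfl fun n _ => stEv_monomial _ _ _ _ _
    rw [h2]
    have h3 : ∀ m ∈ Finset.range p, aeval x (g m) * z ^ m =
        ∑ e ∈ Finset.range (G.natDegree / p + 1),
          algebraMap L Ω (G.coeff (p * e + m)) * (x ^ e * z ^ m) := by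
      intro m _
      simp only [g, map_sum, aeval_monomial, Finset.sum_mul, mul_assoc]
    rw [Finset.sum_congr rfl h3, ← Finset.sum_product']
    refine Finset.sum_nbij' (fun n => (n % p, n / p)) (fun y => p * y.2 + y.1) ?_ ?_ ?_ ?_ ?_
    · intro n hn
      simp only [Finset.mem_range, Finset.mem_product] at hn ⊢
      exact ⟨Nat.mod_lt _ hp0, Nat.div_lt_of_lt_mul hn⟩
    · rintro ⟨m, e⟩ hn
      simp only [Finset.mem_range, Finset.mem_product] at hn ⊢
      have : p * (e + 1) ≤ p * (G.natDegree / p + 1) := Nat.mul_le_mul_left _ (by omega)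
      nlinarith
    · intro n hn
      exact Nat.div_add_mod n p
    · rintro ⟨m, e⟩ hn
      simp only [Finset.mem_range, Finset.mem_product] at hn ⊢
      rw [Nat.mul_add_mod, Nat.mod_eq_of_lt hn.1, Nat.mul_add_div hp0, Nat.div_eq_of_lt hn.1]; simp
    · intro n hn
      simp only [Nat.div_add_mod]
  have hroot : ∀ m < p, ∀ x ∈ A, (g m).eval x = 0 := by
    intro m hm x hx
    obtain ⟨z, hz⟩ := hA x hx
    let Pl : Polynomial Ω := ∑ m ∈ Finset.range p, monomial m (aeval (algebraMap L Ω x) (g m))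
    have hPl : Pl = 0 := by
      refine eq_zero_of_natDegree_lt_card_of_eval_eq_zero' Pl
        ((Finset.range p).image fun t : ℕ => z + (t : Ω)) ?_ ?_
      · intro w hw
        obtain ⟨t, _, rfl⟩ := Finset.mem_image.mp hw
        have := hz t
        rw [hev] at this
        simpa [Pl, eval_finsetSum] using this
      · rw [Finset.card_image_of_injOn, Finset.card_range]
        · refine lt_of_le_of_lt (natDegree_sum_le_of_forall_le (n := p - 1) _ _ ?_) (by omega)
          intro i hi
          have := Finset.mem_range.mp hi
          exact (natDegree_monomial_le _).trans (by omega)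
        · intro s hs t ht hst
          have h5 : (s : Ω) = t := by simpa using hst
          have h6 := (CharP.natCast_eq_natCast Ω p).mp h5
          simp only [Finset.coe_range, Set.mem_Iio] at hs ht
          exact Nat.ModEq.eq_of_lt_of_lt h6 hs ht
    have h7 := congrArg (fun y => coeff y m) hPl
    simp only [Pl, finsetSum_coeff, coeff_monomial, coeff_zero] at h7
    rw [Finset.sum_ite_eq' ] at h7
    simp only [Finset.mem_range, hm, if_true] at h7
    rw [aeval_algebraMap_apply] at h7
    simpa using h7
  have hex : ∃ m < p, g m ≠ 0 := by
    by_contra hcon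
    push Not at hcon
    apply hG
    ext n
    by_cases hn : n ≤ G.natDegree
    · have h8 := congrArg (fun y => coeff y (n / p)) (hcon (n % p) (Nat.mod_lt _ hp0))
      simp only [g, finsetSum_coeff, coeff_monomial, coeff_zero] at h8
      rw [Finset.sum_ite_eq'] at h8
      have h9 : n / p ≤ G.natDegree / p := Nat.div_le_div_right hn
      simpa [Nat.lt_succ_iff, h9, Nat.div_add_mod] using h8
    · simp [coeff_eq_zero_of_natDegree_lt (not_le.mp hn)]
  obtain ⟨m, hm, hgm⟩ := hex
  have h10 : A ⊆ (g m).roots.toFinset := by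
    intro x hx
    simp only [Multiset.mem_toFinset, mem_roots hgm, IsRoot]
    exact hroot m hm x hx
  refine (Finset.card_le_card h10).trans ((Multiset.toFinset_card_le _).trans
    ((card_roots' _).trans ?_))
  refine natDegree_sum_le_of_forall_le _ _ fun e he => ?_
  have := Finset.mem_range.mp he
  exact (natDegree_monomial_le _).trans (by omega)

lemma st_pow_iter (p : ℕ) [Fact p.Prime] [CharP Ω p] (z f : Ω) (h : z ^ p = z + f) (n : ℕ) :
    z ^ (p ^ n) = z + ∑ i ∈ Finset.range n, f ^ (p ^ i) := by
  induction n with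
  | zero => simp
  | succ n ih =>
    rw [pow_succ p, mul_comm, pow_mul, h, add_pow_char_pow, ih, Finset.sum_range_succ, add_assoc]

noncomputable def stTau (p n : ℕ) (a b : L) : L[X] :=
  ∑ i ∈ Finset.range n, (C (a ^ p ^ i) * X ^ (p ^ (n - 1) + p ^ i) +
    C (b ^ p ^ i) * X ^ (p ^ (n - 1) - p ^ i))

lemma stTau_eval (p n : ℕ) (hp : 1 ≤ p) (a b : L) (x : Ω) (hx : x ≠ 0) :
    aeval x (stTau p n a b) = x ^ (p ^ (n - 1)) *
      ∑ i ∈ Finset.range n, ((algebraMap L Ω a * x) ^ p ^ i + (algebraMap L Ω b * x⁻¹) ^ p ^ i) := by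
  unfold stTau
  rw [map_sum, Finset.mul_sum]
  refine Finset.sum_congr rfl fun i hi => ?_
  have hi := Finset.mem_range.mp hi
  have h1 : p ^ i ≤ p ^ (n - 1) := Nat.pow_le_pow_right hp (by omega)
  simp only [map_add, map_mul, aeval_C, map_pow, aeval_X, mul_pow, inv_pow]
  rw [pow_add, pow_sub₀ _ hx h1]; ring

lemma stTau_natDegree (p n : ℕ) (hp : 2 ≤ p) (hn : 1 ≤ n) (a b c : L) (ha : a ≠ 0) :
    (stTau p n a b - C c * X ^ (p ^ (n - 1))).natDegree = 2 * p ^ (n - 1) := by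
  have hR : 1 ≤ p ^ (n - 1) := Nat.one_le_pow _ _ (by omega)
  apply natDegree_eq_of_le_of_coeff_ne_zero
  · refine (natDegree_sub_le _ _).trans (max_le ?_ ?_)
    · refine natDegree_sum_le_of_forall_le _ _ fun i hi => ?_
      have hi := Finset.mem_range.mp hi
      have h1 : p ^ i ≤ p ^ (n - 1) := Nat.pow_le_pow_right (by omega) (by omega)
      refine (natDegree_add_le _ _).trans (max_le ?_ ?_)
      · exact (natDegree_C_mul_X_pow_le _ _).trans (by omega)
      · exact (natDegree_C_mul_X_pow_le _ _).trans (by omega)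
    · exact (natDegree_C_mul_X_pow_le _ _).trans (by omega)
  · unfold stTau
    rw [coeff_sub, coeff_C_mul_X_pow, if_neg (by omega), finsetSum_coeff,
      Finset.sum_eq_single (n - 1)]
    · rw [coeff_add, coeff_C_mul_X_pow, coeff_C_mul_X_pow, if_pos (by omega), if_neg (by omega)]
      simpa using fun h => absurd h ha
    · intro i hi hne
      have hi := Finset.mem_range.mp hi
      have h1 : p ^ i < p ^ (n - 1) := Nat.pow_lt_pow_right (by omega) (by omega)
      rw [coeff_add, coeff_C_mul_X_pow, coeff_C_mul_X_pow, if_neg (by omega), if_neg (by omega)]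
      simp
    · intro h; exact absurd (Finset.mem_range.mpr (by omega)) h

theorem stepanov_bound [Fintype L] [DecidableEq L] (p n : ℕ) [Fact p.Prime] [CharP L p] (hp3 : 3 ≤ p)
    (hn : 1 ≤ n) (hcard : Fintype.card L = p ^ (2 * n)) (a b c : L) (ha : a ≠ 0) (hc : c ^ p = c) :
    (Finset.univ.filter fun x : L => x ≠ 0 ∧
      ∑ i ∈ Finset.range (2 * n), (a * x + b * x⁻¹) ^ p ^ i = c).card
      ≤ p ^ (n - 1) * p ^ n + 5 * p ^ n := by
  classical
  have hpp : p.Prime := Fact.out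
  obtain ⟨R, hRdef⟩ : ∃ R, R = p ^ (n - 1) := ⟨_, rfl⟩
  obtain ⟨P, hPdef⟩ : ∃ P, P = p ^ n := ⟨_, rfl⟩
  have hR : 1 ≤ R := hRdef ▸ Nat.one_le_pow _ _ (by omega)
  have hPR : P = p * R := by
    rw [hPdef, hRdef, ← pow_succ']; congr 1; omega
  have hPP : P * P = Fintype.card L := by rw [hcard, hPdef, two_mul, pow_add]
  have hPQ : ∀ y : L, (y ^ P) ^ P = y := fun y => by
    rw [← pow_mul, hPP, FiniteField.pow_card]
  have hcn : ∀ m, c ^ p ^ m = c := by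
    intro m
    induction m with
    | zero => simp
    | succ m ih => rw [pow_succ, pow_mul, ih, hc]
  set τ := stTau p n a b with hτdef
  set τ' := stTau p n a b - C c * X ^ R with hτ'def
  have hτ : τ.natDegree = 2 * R := by
    have := stTau_natDegree p n (by omega) hn a b 0 ha
    rw [hRdef]; simpa using this
  have hτ' : τ'.natDegree = 2 * R := by
    have := stTau_natDegree p n (by omega) hn a b c ha
    rw [hτ'def, hRdef]; exact this
  let D := R * P + P + (R + 4) + 1
  let h1 : Fin R × Fin p × Fin (R + 4) × Fin p → L[X] := fun y =>
    X ^ (p * (y.1 * P + y.2.2.1)) * stTheta p R a b τ y.2.1 y.2.2.2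
  let g1 : Fin R × Fin p × Fin (R + 4) × Fin p → L[X] := fun y =>
    X ^ (p * (y.1 + y.2.2.1 * P)) * stTheta p R a b τ' y.2.2.2 y.2.1
  have h1deg : ∀ y, (h1 y).natDegree < p * D := by
    rintro ⟨k, l, i, j⟩
    refine lt_of_le_of_lt natDegree_mul_le ?_
    rw [natDegree_X_pow, (stTheta_natDegree p R (by omega) hR a b τ hτ l j l.2 j.2).2]
    simp only [D]
    have hk : (k : ℕ) * P + P ≤ R * P := by
      have : ((k : ℕ) + 1) * P ≤ R * P := Nat.mul_le_mul_right _ k.2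
      linarith
    have hl : R * (p - 1 + l) ≤ R * (p + p) := Nat.mul_le_mul_left _ (by omega)
    have hi := i.2
    have hj := j.2
    have : p * (k * P + i) + (p * (R * (p - 1 + l) + 1) + j) <
      p * ((k * P + i) + (R * (p - 1 + l) + 1) + 1) := by nlinarith
    refine lt_of_lt_of_le this (Nat.mul_le_mul_left _ ?_)
    have e : R * (p + p) = 2 * P := by rw [hPR]; ring
    omega
  have g1deg : ∀ y, g1 y ≠ 0 ∧ (g1 y).natDegree =
      p * (y.1 + R * y.2.2.2 + R * p * y.2.2.1 + (R * (p - 1) + 1)) + y.2.1 := by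
    rintro ⟨k, l, i, j⟩
    obtain ⟨q1, q2⟩ := stTheta_natDegree p R (by omega) hR a b τ' hτ' j l j.2 l.2
    have q3 : (X ^ (p * ((k : ℕ) + i * P)) : L[X]) ≠ 0 := pow_ne_zero _ X_ne_zero
    refine ⟨mul_ne_zero q3 q1, ?_⟩
    simp only [g1]
    rw [natDegree_mul q3 q1, q2, natDegree_X_pow, hPR]
    ring
  have g1inj : Function.Injective fun y => (g1 y).natDegree := by
    rintro ⟨k, l, i, j⟩ ⟨k', l', i', j'⟩ h
    simp only [g1deg] at h
    have hp0 : 0 < p := by omega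
    have e1 := congrArg (· % p) h
    have e2 := congrArg (· / p) h
    simp only [Nat.mul_add_mod, Nat.mod_eq_of_lt l.2, Nat.mod_eq_of_lt l'.2] at e1
    simp only [Nat.mul_add_div hp0, Nat.div_eq_of_lt l.2, Nat.div_eq_of_lt l'.2, add_zero] at e2
    have e3 : R * (p * i + j) + k = R * (p * i' + j') + k' := by linarith
    have e4 := congrArg (· % R) e3
    have e5 := congrArg (· / R) e3
    simp only [Nat.mul_add_mod, Nat.mod_eq_of_lt k.2, Nat.mod_eq_of_lt k'.2] at e4
    simp only [Nat.mul_add_div hR, Nat.div_eq_of_lt k.2, Nat.div_eq_of_lt k'.2, add_zero] at e5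
    have e6 := congrArg (· % p) e5
    have e7 := congrArg (· / p) e5
    simp only [Nat.mul_add_mod, Nat.mod_eq_of_lt j.2, Nat.mod_eq_of_lt j'.2] at e6
    simp only [Nat.mul_add_div hp0, Nat.div_eq_of_lt j.2, Nat.div_eq_of_lt j'.2, add_zero] at e7
    simp only [Prod.mk.injEq]
    exact ⟨Fin.ext e4, Fin.ext e1, Fin.ext e7, Fin.ext e6⟩
  let Φ : (Fin R × Fin p × Fin (R + 4) × Fin p → L) →ₗ[L] (Fin (p * D) → L) :=
    LinearMap.pi fun e => (lcoeff L e).comp (Fintype.linearCombination L h1)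
  have hker : LinearMap.ker Φ ≠ ⊥ := by
    apply LinearMap.ker_ne_bot_of_finrank_lt
    simp only [Module.finrank_fintype_fun_eq_card, Fintype.card_prod, Fintype.card_fin]
    have : D < R * p * (R + 4) := by
      have e : R * p = P := by rw [hPR]; ring
      rw [e]
      simp only [D]
      have : 3 * R ≤ P := by rw [hPR]; exact Nat.mul_le_mul_right _ hp3
      nlinarith
    calc p * D < p * (R * p * (R + 4)) := Nat.mul_lt_mul_of_pos_left this (by omega)
      _ = _ := by ring
  obtain ⟨γ, hγker, hγ0⟩ := (Submodule.ne_bot_iff _).mp hker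
  have hH : ∑ y, γ y • h1 y = 0 := by
    ext e
    by_cases he : e < p * D
    · have := congrFun (LinearMap.mem_ker.mp hγker) ⟨e, he⟩
      simpa [Φ, Fintype.linearCombination_apply] using this
    · rw [coeff_zero, finsetSum_coeff]
      refine Finset.sum_eq_zero fun y _ => ?_
      rw [coeff_smul, coeff_eq_zero_of_natDegree_lt (lt_of_lt_of_le (h1deg y) (not_lt.mp he)),
        smul_zero]
  set G : L[X] := ∑ y, (γ y ^ P) • g1 y with hGdef
  have hG0 : G ≠ 0 := by
    refine st_sum_ne_zero g1 (fun y => (g1deg y).1) g1inj (fun y => γ y ^ P) ?_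
    obtain ⟨y, hy⟩ := Function.ne_iff.mp hγ0
    exact Function.ne_iff.mpr ⟨y, pow_ne_zero _ hy⟩
  have hGdeg : G.natDegree / p ≤ R * P + 5 * P := by
    apply Nat.le_of_lt_succ
    apply Nat.div_lt_of_lt_mul
    refine lt_of_le_of_lt (natDegree_sum_le_of_forall_le (n := p * (R * P + 5 * P + 1) - 1) _ _ ?_) ?_
    · rintro ⟨k, l, i, j⟩ _
      refine (natDegree_smul_le _ _).trans ?_
      rw [(g1deg _).2]
      apply Nat.le_sub_one_of_lt
      simp only
      have hk := k.2
      have hl := l.2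
      have hi : R * p * i ≤ P * (R + 3) := by
        rw [hPR, mul_comm p]; exact Nat.mul_le_mul_left _ (by omega)
      have hj : R * j + R ≤ P := by
        have : R * (j + 1) ≤ R * p := Nat.mul_le_mul_left _ j.2
        rw [hPR]; linarith
      have hj2 : R * (p - 1) + R = P := by
        obtain ⟨m, rfl⟩ : ∃ m, p = m + 1 := ⟨p - 1, by omega⟩
        rw [hPR]; simp; ring
      have : k + R * j + R * p * i + (R * (p - 1) + 1) + 1 ≤ R * P + 5 * P + 1 := by nlinarith
      have := Nat.mul_le_mul_left p this
      nlinarith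
    · have : 0 < p * (R * P + 5 * P + 1) := by positivity
      simp only [Nat.succ_eq_add_one]
      omega
  rw [← hRdef, ← hPdef]
  have : CharP (AlgebraicClosure L) p :=
    charP_of_injective_algebraMap (algebraMap L (AlgebraicClosure L)).injective p
  refine (st_count (Ω := AlgebraicClosure L) p hpp G hG0 _ ?_).trans hGdeg
  intro x hx
  simp only [Finset.mem_filter, Finset.mem_univ, true_and] at hx
  obtain ⟨hx0, hxc⟩ := hx
  set φ := algebraMap L (AlgebraicClosure L) with hφ
  have hφx : φ x ≠ 0 := by simpa using hx0
  obtain ⟨z, hz⟩ : ∃ z : AlgebraicClosure L, z ^ p = z + φ (a * x + b * x⁻¹) := by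
    have hdeg : (X ^ p + (- X - C (φ (a * x + b * x⁻¹))) : Polynomial (AlgebraicClosure L)).degree ≠ 0 := by
      have : (X ^ p + (- X - C (φ (a * x + b * x⁻¹))) : Polynomial (AlgebraicClosure L)).natDegree = p := by
        rw [natDegree_add_eq_left_of_natDegree_lt]
        · simp
        · rw [natDegree_X_pow]
          refine lt_of_le_of_lt (natDegree_sub_le _ _) ?_
          rw [natDegree_neg, natDegree_X, natDegree_C]; omega
      intro h
      have := natDegree_eq_zero_iff_degree_le_zero.mpr h.le
      omega
    obtain ⟨z, hz⟩ := IsAlgClosed.exists_root _ hdeg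
    refine ⟨z, ?_⟩
    simp [IsRoot] at hz
    rw [map_add, map_mul, map_mul, map_inv₀]
    linear_combination hz
  refine ⟨z, fun t => ?_⟩
  set w := z + (t : AlgebraicClosure L) with hw
  have hwp : w ^ p = w + φ (a * x + b * x⁻¹) := by
    rw [hw, add_pow_char, hz]
    have : (t : AlgebraicClosure L) ^ p = t := by
      have := map_natCast (frobenius (AlgebraicClosure L) p) t
      rwa [frobenius_def] at this
    rw [this]; ring
  have hrel : φ x * (w ^ p - w) = φ a * φ x ^ 2 + φ b := by
    rw [hwp]; simp only [map_add, map_mul, map_inv₀]; field_simp; ring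
  have hwP := st_pow_iter p w _ hwp n
  have hwQ : w ^ (p ^ (2 * n)) = w + φ c := by
    rw [st_pow_iter p w _ hwp (2 * n), ← hxc, map_sum]
    simp
  set T := ∑ i ∈ Finset.range n, (φ (a * x + b * x⁻¹)) ^ p ^ i with hT
  have hτx : aeval (φ x) τ = φ x ^ R * T := by
    rw [hτdef, stTau_eval p n (by omega) a b (φ x) hφx, hRdef]
    congr 1
    refine Finset.sum_congr rfl fun i _ => ?_
    rw [← add_pow_char_pow]
    simp only [map_add, map_mul, map_inv₀, hφ]
  have hτ'x : aeval (φ x) τ' = φ x ^ R * (T - φ c) := by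
    rw [hτ'def, map_sub, ← hτdef, hτx]
    simp [hφ]; ring
  have hTc : (w + (T - φ c)) ^ P = w := by
    have : w + (T - φ c) = w ^ (p ^ n) - φ c := by rw [hwP]; ring
    rw [this, hPdef, sub_pow_char_pow, ← pow_mul, ← pow_add, ← two_mul, hwQ, ← map_pow, hcn]
    ring
  have hTP : w + T = w ^ P := by rw [hPdef, hwP]
  set M := R * (p - 1) + 1 with hM
  have evh : ∀ y, stEv p (φ x) w (h1 y) = φ x ^ M *
      (φ x ^ ((y.1 : ℕ) * P + y.2.2.1) * w ^ (y.2.2.2 : ℕ) * (w ^ P) ^ (y.2.1 : ℕ)) := by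
    intro y
    simp only [h1]
    have : (X ^ (p * ((y.1 : ℕ) * P + y.2.2.1)) : L[X]) = expand L p (X ^ ((y.1 : ℕ) * P + y.2.2.1)) := by
      simp [pow_mul]
    rw [this, stEv_expand_mul p (by omega),
      stEv_theta p R (by omega) a b τ (φ x) w T hrel hτx _ _ y.2.1.2 y.2.2.2.2, hTP]
    simp only [map_pow, aeval_X]; ring
  have evg : ∀ y, stEv p (φ x) w (g1 y) = φ x ^ M *
      (φ x ^ ((y.1 : ℕ) + y.2.2.1 * P) * w ^ (y.2.1 : ℕ) * (w + (T - φ c)) ^ (y.2.2.2 : ℕ)) := by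
    intro y
    simp only [g1]
    have : (X ^ (p * ((y.1 : ℕ) + y.2.2.1 * P)) : L[X]) = expand L p (X ^ ((y.1 : ℕ) + y.2.2.1 * P)) := by
      simp [pow_mul]
    rw [this, stEv_expand_mul p (by omega),
      stEv_theta p R (by omega) a b τ' (φ x) w (T - φ c) hrel hτ'x _ _ y.2.2.2.2 y.2.1.2]
    simp only [map_pow, aeval_X]; ring
  have hxPP : (φ x ^ P) ^ P = φ x := by rw [← map_pow, ← map_pow, hPQ]
  have z1 : ∑ y : Fin R × Fin p × Fin (R + 4) × Fin p, φ (γ y) *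
      (φ x ^ ((y.1 : ℕ) * P + y.2.2.1) * w ^ (y.2.2.2 : ℕ) * (w ^ P) ^ (y.2.1 : ℕ)) = 0 := by
    have := congrArg (stEv p (φ x) w) hH
    rw [map_sum, map_zero] at this
    have h2 : φ x ^ M * ∑ y : Fin R × Fin p × Fin (R + 4) × Fin p, φ (γ y) *
      (φ x ^ ((y.1 : ℕ) * P + y.2.2.1) * w ^ (y.2.2.2 : ℕ) * (w ^ P) ^ (y.2.1 : ℕ)) = 0 := by
      rw [← this, Finset.mul_sum]
      refine Finset.sum_congr rfl fun y _ => ?_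
      rw [map_smul, evh, Algebra.smul_def]; ring
    exact (mul_eq_zero.mp h2).resolve_left (pow_ne_zero _ hφx)
  have z2 : stEv p (φ x) w G = φ x ^ M * ∑ y : Fin R × Fin p × Fin (R + 4) × Fin p, φ (γ y) ^ P *
      (φ x ^ ((y.1 : ℕ) + y.2.2.1 * P) * w ^ (y.2.1 : ℕ) * (w + (T - φ c)) ^ (y.2.2.2 : ℕ)) := by
    rw [hGdef, map_sum, Finset.mul_sum]
    refine Finset.sum_congr rfl fun y _ => ?_
    rw [map_smul, evg, Algebra.smul_def, map_pow]; ring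
  rw [z2]
  refine mul_eq_zero_of_right _ ?_
  have hP0 : P ≠ 0 := by rw [hPR]; positivity
  refine (pow_eq_zero_iff hP0).mp ?_
  rw [hPdef, sum_pow_char_pow, ← hPdef, ← z1]
  refine Finset.sum_congr rfl fun y _ => ?_
  have q1 : (φ (γ y) ^ P) ^ P = φ (γ y) := by rw [← map_pow, ← map_pow, hPQ]
  have q2 : (φ x ^ ((y.1 : ℕ) + y.2.2.1 * P)) ^ P = φ x ^ ((y.1 : ℕ) * P + y.2.2.1) := by
    rw [pow_add, mul_pow, pow_add, ← pow_mul]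
    congr 1
    rw [mul_comm (y.2.2.1 : ℕ) P, pow_mul, ← pow_mul, mul_comm (y.2.2.1 : ℕ) P, pow_mul, hxPP]
  have q3 : ((w + (T - φ c)) ^ (y.2.2.2 : ℕ)) ^ P = w ^ (y.2.2.2 : ℕ) := by
    rw [← pow_mul, mul_comm, pow_mul, hTc]
  rw [mul_pow, mul_pow, mul_pow, q1, q2, q3, ← pow_mul, ← pow_mul, mul_comm P]
  ring
end Stepanov

section Kloosterman
open scoped Classical

lemma kl_sum_sq {F : Type} [Field F] [Fintype F] (hF : ringChar F ≠ 2) (g : F → ℂ) :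
    ∑ v, g (v ^ 2) = ∑ w, g w * (1 + ((quadraticChar F w : ℤ) : ℂ)) := by
  have h1 : ∀ w : F, ∑ v ∈ Finset.univ.filter (fun v : F => v ^ 2 = w), g (v ^ 2) =
      g w * (1 + ((quadraticChar F w : ℤ) : ℂ)) := by
    intro w
    have h2 := quadraticChar_card_sqrts hF w
    have h3 : ((Finset.univ.filter (fun v : F => v ^ 2 = w)).card : ℤ) = quadraticChar F w + 1 := by
      rw [← h2]; congr 2; ext v; simp
    rw [Finset.sum_congr rfl (g := fun _ => g w) (fun v hv => by rw [(Finset.mem_filter.mp hv).2]),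
      Finset.sum_const, nsmul_eq_mul]
    have h4 : ((Finset.univ.filter (fun v : F => v ^ 2 = w)).card : ℂ) =
        ((quadraticChar F w : ℤ) : ℂ) + 1 := by exact_mod_cast h3
    rw [h4]; ring
  rw [← Finset.sum_congr rfl (fun w _ => h1 w)]
  exact (Finset.sum_fiberwise _ _ _).symm

lemma kl_sum_two {F : Type} [Field F] [Fintype F] (hF : ringChar F ≠ 2) (δ : F)
    (hδ : quadraticChar F δ = -1) (g : F → ℂ) :
    ∑ v, g (v ^ 2) + ∑ v, g (δ * v ^ 2) = 2 * ∑ w, g w := by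
  have hδ0 : δ ≠ 0 := by rintro rfl; simp at hδ
  rw [kl_sum_sq hF g, kl_sum_sq hF (fun w => g (δ * w))]
  have h1 : ∑ w, g w * (1 - ((quadraticChar F w : ℤ) : ℂ)) =
      ∑ w, g (δ * w) * (1 + ((quadraticChar F w : ℤ) : ℂ)) := by
    rw [← Equiv.sum_comp (Equiv.mulLeft₀ δ hδ0)]
    refine Finset.sum_congr rfl fun w _ => ?_
    simp only [Equiv.mulLeft₀_apply, map_mul, hδ]
    push_cast; ring
  rw [← h1, ← Finset.sum_add_distrib, Finset.mul_sum]
  refine Finset.sum_congr rfl fun w _ => ?_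
  ring

noncomputable def klSum {F : Type} [Field F] [Fintype F] (ψ : AddChar F ℂ) (a b : F) : ℂ :=
  ∑ x : F, if x = 0 then 0 else ψ (a * x + b * x⁻¹)

noncomputable def klG {F : Type} [Field F] (ψ : AddChar F ℂ) (a b u w : F) : ℂ :=
  if u ^ 2 - w = 0 then 0 else ψ (u * (2 * (a + b * (u ^ 2 - w)⁻¹)))

lemma kl_two_ne {F : Type} [Field F] (hF : ringChar F ≠ 2) : (2 : F) ≠ 0 := Ring.two_ne_zero hF

noncomputable def klEquiv {F : Type} [Field F] (h2 : (2 : F) ≠ 0) : F × F ≃ F × F where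
  toFun y := (y.1 + y.2, y.1 - y.2)
  invFun y := ((y.1 + y.2) / 2, (y.1 - y.2) / 2)
  left_inv y := by ext <;> simp <;> field_simp <;> ring
  right_inv y := by ext <;> simp <;> field_simp <;> ring

lemma klSum_sq {F : Type} [Field F] [Fintype F] (hF : ringChar F ≠ 2) (ψ : AddChar F ℂ) (a b : F) :
    klSum ψ a b ^ 2 = ∑ u, ∑ v, klG ψ a b u (v ^ 2) := by
  have h2 := kl_two_ne hF
  rw [sq, klSum, Finset.sum_mul_sum, ← Fintype.sum_prod_type', ← Fintype.sum_prod_type',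
    ← (klEquiv h2).sum_comp]
  refine Finset.sum_congr rfl fun y _ => ?_
  obtain ⟨u, v⟩ := y
  rw [klG]
  change (if u + v = 0 then (0 : ℂ) else ψ (a * (u + v) + b * (u + v)⁻¹)) *
    (if u - v = 0 then (0 : ℂ) else ψ (a * (u - v) + b * (u - v)⁻¹)) = _
  have e : u ^ 2 - v ^ 2 = (u + v) * (u - v) := by ring
  by_cases h3 : u + v = 0
  · simp [h3, e]
  by_cases h4 : u - v = 0
  · simp [h4, e]
  rw [if_neg h3, if_neg h4, e, if_neg (mul_ne_zero h3 h4), ← AddChar.map_add_eq_mul]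
  congr 1
  field_simp; ring

lemma klG_sum {F : Type} [Field F] [Fintype F] (hF : ringChar F ≠ 2) (ψ : AddChar F ℂ)
    (hψ : ψ.IsPrimitive) (a b : F) (ha : a ≠ 0) (hb : b ≠ 0) :
    ∑ u, ∑ w, klG ψ a b u w = Fintype.card F := by
  have h2 := kl_two_ne hF
  have h1 : ∀ u, ∑ w, klG ψ a b u w =
      ∑ N, if N = 0 then 0 else ψ (u * (2 * (a + b * N⁻¹))) := by
    intro u
    rw [← (Equiv.subLeft (u ^ 2)).sum_comp]
    refine Finset.sum_congr rfl fun w _ => ?_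
    simp [klG]
  rw [Finset.sum_congr rfl fun u _ => h1 u, Finset.sum_comm]
  have h3 : ∀ N : F, ∑ u, (if N = 0 then 0 else ψ (u * (2 * (a + b * N⁻¹)))) =
      if N = -b / a then (Fintype.card F : ℂ) else 0 := by
    intro N
    by_cases hN : N = 0
    · have : (0 : F) ≠ -b / a := by
        intro h; field_simp at h; exact hb (by simpa using h)
      simp [hN, this]
    · simp only [hN, if_false]
      rw [AddChar.sum_mulShift _ hψ]
      have : 2 * (a + b * N⁻¹) = 0 ↔ N = -b / a := by
        rw [mul_eq_zero, or_iff_right h2]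
        field_simp
        constructor <;> intro h <;> linear_combination h
      simp [this]
  rw [Finset.sum_congr rfl fun N _ => h3 N]
  simp

lemma kl_quad {F : Type} [Field F] [Fintype F] (hF : ringChar F ≠ 2) (δ : F)
    (hδ : quadraticChar F δ = -1) [Fact (∀ r : F, r ^ 2 ≠ δ + 0 * r)]
    [Fintype (QuadraticAlgebra F δ 0)]
    (ψ : AddChar F ℂ) (hψ : ψ.IsPrimitive) (ψ' : AddChar (QuadraticAlgebra F δ 0) ℂ)
    (h : ∀ z, ψ' z = ψ (2 * z.re)) (a b : F) (ha : a ≠ 0) (hb : b ≠ 0) :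
    klSum ψ' (algebraMap F _ a) (algebraMap F _ b) = 2 * Fintype.card F - klSum ψ a b ^ 2 := by
  have h1 : klSum ψ' (algebraMap F _ a) (algebraMap F _ b) =
      ∑ u, ∑ v, klG ψ a b u (δ * v ^ 2) := by
    rw [klSum, ← Fintype.sum_prod_type', ← (QuadraticAlgebra.equivProd δ 0).symm.sum_comp]
    refine Finset.sum_congr rfl fun y _ => ?_
    obtain ⟨u, v⟩ := y
    set z : QuadraticAlgebra F δ 0 := (QuadraticAlgebra.equivProd δ 0).symm (u, v) with hz
    have zr : z.re = u := rfl
    have zi : z.im = v := rfl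
    have zn : z.norm = u ^ 2 - δ * v ^ 2 := by
      rw [QuadraticAlgebra.norm_def, zr, zi]; ring
    have zz : z = 0 ↔ u ^ 2 - δ * v ^ 2 = 0 := by
      rw [← zn, QuadraticAlgebra.norm_eq_zero_iff_eq_zero]
    simp only [klG, zz]
    split_ifs with hc
    · rfl
    · rw [h]
      congr 1
      have hinv : z⁻¹ = ⟨u * (u ^ 2 - δ * v ^ 2)⁻¹, -v * (u ^ 2 - δ * v ^ 2)⁻¹⟩ := by
        apply inv_eq_of_mul_eq_one_right
        ext
        · change _ = (1 : F)
          simp [zr, zi]; field_simp; ring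
        · change _ = (0 : F)
          simp [zr, zi]; ring
      rw [hinv]
      simp [zr, zi]
      ring
  rw [h1, klSum_sq hF]
  have h5 := klG_sum hF ψ hψ a b ha hb
  have h6 : ∑ u, ∑ v, klG ψ a b u (v ^ 2) + ∑ u, ∑ v, klG ψ a b u (δ * v ^ 2) =
      2 * ∑ u, ∑ w, klG ψ a b u w := by
    rw [← Finset.sum_add_distrib, Finset.mul_sum]
    exact Finset.sum_congr rfl fun u _ => kl_sum_two hF δ hδ _
  rw [h5] at h6
  linear_combination h6

noncomputable def klPsi (p : ℕ) [Fact p.Prime] (F : Type) [Field F] [Algebra (ZMod p) F] :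
    AddChar F ℂ :=
  (ZMod.stdAddChar (N := p)).compAddMonoidHom (Algebra.trace (ZMod p) F).toAddMonoidHom

lemma klPsi_apply (p : ℕ) [Fact p.Prime] (F : Type) [Field F] [Algebra (ZMod p) F] (x : F) :
    klPsi p F x = ZMod.stdAddChar (Algebra.trace (ZMod p) F x) := rfl

lemma klPsi_primitive (p : ℕ) [Fact p.Prime] (F : Type) [Field F] [Fintype F] [Algebra (ZMod p) F] :
    (klPsi p F).IsPrimitive := by
  apply AddChar.IsPrimitive.of_ne_one
  intro h
  obtain ⟨x, hx⟩ := Algebra.trace_surjective (ZMod p) F 1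
  have h1 : klPsi p F x = 1 := by rw [h]; rfl
  rw [klPsi_apply, hx, ← (ZMod.stdAddChar (N := p)).map_zero_eq_one] at h1
  exact one_ne_zero (ZMod.injective_stdAddChar h1)

lemma kl_step (p : ℕ) [Fact p.Prime] (F : Type) [Field F] [Fintype F] [Algebra (ZMod p) F]
    (hF : ringChar F ≠ 2) :
    ∃ (L : Type) (_ : Field L) (_ : Fintype L) (_ : Algebra (ZMod p) L) (φ : F →+* L),
      Fintype.card L = Fintype.card F ^ 2 ∧ ∀ a b : F, a ≠ 0 → b ≠ 0 →
        klSum (klPsi p L) (φ a) (φ b) = 2 * Fintype.card F - klSum (klPsi p F) a b ^ 2 := by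
  obtain ⟨δ, hδ⟩ := quadraticChar_exists_neg_one hF
  have hfact : Fact (∀ r : F, r ^ 2 ≠ δ + 0 * r) := ⟨fun r hr => by
    have h1 := quadraticChar_neg_one_iff_not_isSquare.mp hδ
    exact h1 ⟨r, by rw [← sq, hr]; ring⟩⟩
  let ft : Fintype (QuadraticAlgebra F δ 0) := Fintype.ofEquiv _ (QuadraticAlgebra.equivProd δ 0).symm
  refine ⟨QuadraticAlgebra F δ 0, inferInstance, ft, inferInstance, algebraMap F _, ?_, ?_⟩
  · rw [Fintype.card_congr (QuadraticAlgebra.equivProd δ 0), Fintype.card_prod, sq]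
  · intro a b ha hb
    refine kl_quad hF δ hδ _ (klPsi_primitive p F) _ ?_ a b ha hb
    intro z
    rw [klPsi_apply, klPsi_apply, ← Algebra.trace_trace (S := F)]
    congr 2
    rw [Algebra.trace_eq_matrix_trace (QuadraticAlgebra.basis δ 0), Matrix.trace_fin_two,
      Algebra.leftMulMatrix_eq_repr_mul, Algebra.leftMulMatrix_eq_repr_mul]
    simp [QuadraticAlgebra.basis]
    ring

end Kloosterman

section Weil
open scoped Classical

def klIter (y : ℝ) : ℕ → ℝ
  | 0 => y
  | (j + 1) => klIter y j ^ 2 - 2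

lemma klIter_unbounded (y : ℝ) (hy : 2 < |y|) (B : ℝ) : ∃ j, B < klIter y (j + 1) := by
  have h0 : 0 < klIter y 1 - 2 := by
    simp only [klIter]
    have : 2 ^ 2 < |y| ^ 2 := by gcongr
    rw [sq_abs] at this; linarith
  have h1 : ∀ j : ℕ, (klIter y 1 - 2) * 4 ^ j ≤ klIter y (j + 1) - 2 := by
    intro j
    induction j with
    | zero => simp
    | succ j ih =>
      have h2 : 0 ≤ klIter y (j + 1) - 2 := le_trans (by positivity) ih
      have h3 : klIter y (j + 1 + 1) = klIter y (j + 1) ^ 2 - 2 := rfl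
      rw [h3, pow_succ]
      nlinarith
  obtain ⟨j, hj⟩ := pow_unbounded_of_one_lt ((|B|) / (klIter y 1 - 2)) (by norm_num : (1:ℝ) < 4)
  refine ⟨j, ?_⟩
  rw [div_lt_iff₀ h0] at hj
  have := h1 j
  have := le_abs_self B
  nlinarith

lemma kl_conj {F : Type} [Field F] [Fintype F] (ψ : AddChar F ℂ) (a b : F) :
    (starRingEnd ℂ) (klSum ψ a b) = klSum ψ a b := by
  unfold klSum
  rw [map_sum, ← Equiv.sum_comp (Equiv.neg F)]
  refine Finset.sum_congr rfl fun x _ => ?_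
  simp only [Equiv.neg_apply, neg_eq_zero]
  split_ifs with h
  · simp
  · rw [← AddChar.map_neg_eq_conj]
    congr 1
    rw [inv_neg]; ring

lemma kl_real {F : Type} [Field F] [Fintype F] (ψ : AddChar F ℂ) (a b : F) :
    klSum ψ a b = ((klSum ψ a b).re : ℂ) :=
  (Complex.conj_eq_iff_re.mp (kl_conj ψ a b)).symm

lemma kl_tower (p : ℕ) [Fact p.Prime] (hp : p ≠ 2) (F : Type) [Field F] [Fintype F] [Algebra (ZMod p) F]
    (j : ℕ) :
    ∃ (L : Type) (_ : Field L) (_ : Fintype L) (_ : Algebra (ZMod p) L) (φ : F →+* L),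
      Fintype.card L = Fintype.card F ^ (2 ^ j) ∧ ∀ a b : F, a ≠ 0 → b ≠ 0 →
        (klSum (klPsi p L) (φ a) (φ b)).re = - (√(Fintype.card L)) *
          klIter (-(klSum (klPsi p F) a b).re / √(Fintype.card F)) j := by
  induction j with
  | zero =>
    refine ⟨F, inferInstance, inferInstance, inferInstance, RingHom.id F, by simp, ?_⟩
    intro a b _ _
    have : √(Fintype.card F : ℝ) ≠ 0 := by
      have : (0 : ℝ) < Fintype.card F := by exact_mod_cast Fintype.card_pos
      positivity
    simp only [RingHom.id_apply, klIter]
    field_simp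
  | succ j ih =>
    obtain ⟨L, i1, i2, i3, φ, hc, hL⟩ := ih
    have hchar : ringChar L ≠ 2 := by
      have : CharP L p := charP_of_injective_algebraMap (algebraMap (ZMod p) L).injective p
      rw [ringChar.eq L p]; exact hp
    obtain ⟨M, j1, j2, j3, θ, hc2, hM⟩ := kl_step p L hchar
    refine ⟨M, j1, j2, j3, θ.comp φ, ?_, ?_⟩
    · rw [hc2, hc, ← pow_mul, pow_succ]
    · intro a b ha hb
      have h1 := hM (φ a) (φ b) (by simpa using ha) (by simpa using hb)
      rw [kl_real (klPsi p L), hL a b ha hb] at h1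
      simp only [RingHom.comp_apply]
      rw [h1]
      have h2 : √(Fintype.card M : ℝ) = Fintype.card L := by
        rw [hc2]; push_cast; exact Real.sqrt_sq (by positivity)
      rw [h2]
      have h3 : √(Fintype.card L : ℝ) ^ 2 = Fintype.card L := Real.sq_sqrt (by positivity)
      simp only [klIter]
      generalize klIter (-(klSum (klPsi p F) a b).re / √(Fintype.card F : ℝ)) j = y
      have h4 : (2 * (Fintype.card L : ℂ) - ((-√(Fintype.card L : ℝ) * y : ℝ) : ℂ) ^ 2) =
        ((2 * (Fintype.card L : ℝ) - (-√(Fintype.card L : ℝ) * y) ^ 2 : ℝ) : ℂ) := by push_cast; ring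
      rw [h4, Complex.ofReal_re]
      rw [mul_pow, neg_sq, h3]; ring

lemma kl_sum_lower (p : ℕ) [Fact p.Prime] (hp : 3 ≤ p) (L : Type) [Field L] [Fintype L]
    [Algebra (ZMod p) L] (n : ℕ) (hn : 1 ≤ n) (hcard : Fintype.card L = p ^ (2 * n)) (a b : L)
    (ha : a ≠ 0) :
    -(5 * (p : ℝ) ^ 2 * p ^ n) ≤ ∑ t ∈ (Finset.univ.erase (0 : ZMod p)),
      (klSum (klPsi p L) (algebraMap (ZMod p) L t * a) (algebraMap (ZMod p) L t * b)).re := by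
  have hchar : CharP L p := charP_of_injective_algebraMap (algebraMap (ZMod p) L).injective p
  let A : ZMod p → Finset L := fun c => Finset.univ.filter fun x : L => x ≠ 0 ∧
    Algebra.trace (ZMod p) L (a * x + b * x⁻¹) = c
  have hfin : Module.finrank (ZMod p) L = 2 * n := by
    have h1 := Module.card_eq_pow_finrank (K := ZMod p) (V := L)
    rw [hcard, ZMod.card] at h1
    exact (Nat.pow_right_injective (by omega : 2 ≤ p) h1).symm
  have hA : ∀ c, (A c).card ≤ p ^ (n - 1) * p ^ n + 5 * p ^ n := by
    intro c
    have hc : (algebraMap (ZMod p) L c) ^ p = algebraMap (ZMod p) L c := by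
      rw [← map_pow, ZMod.pow_card]
    refine le_trans (le_of_eq ?_)
      (stepanov_bound p n hp hn hcard a b (algebraMap (ZMod p) L c) ha hc)
    congr 1
    ext x
    simp only [A, Finset.mem_filter, Finset.mem_univ, true_and]
    have h2 := FiniteField.algebraMap_trace_eq_sum_pow (ZMod p) L (a * x + b * x⁻¹)
    rw [hfin, Nat.card_eq_fintype_card, ZMod.card] at h2
    rw [← h2, (algebraMap (ZMod p) L).injective.eq_iff]
  have hcardne : ((Finset.univ.filter fun x : L => x ≠ 0)).card = p ^ (2 * n) - 1 := by
    rw [← hcard, Finset.filter_ne', Finset.card_erase_of_mem (Finset.mem_univ _), Finset.card_univ]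
  have hsum : ∑ c, (A c).card = p ^ (2 * n) - 1 := by
    rw [← hcardne, Finset.card_eq_sum_card_fiberwise
      (f := fun x : L => Algebra.trace (ZMod p) L (a * x + b * x⁻¹)) (t := Finset.univ)
      (fun _ _ => Finset.mem_coe.mpr (Finset.mem_univ _))]
    refine Finset.sum_congr rfl fun c _ => ?_
    rw [Finset.filter_filter]
  have h0 : (p : ℝ) ^ (2 * n) - 1 ≤ (A 0).card + (p - 1) * (p ^ (n - 1) * p ^ n + 5 * p ^ n) := by
    have h1 : ((p ^ (2 * n) - 1 : ℕ) : ℝ) = (p : ℝ) ^ (2 * n) - 1 := by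
      rw [Nat.cast_sub (Nat.one_le_pow _ _ (by omega))]; push_cast; rfl
    rw [← h1, ← hsum, ← Finset.add_sum_erase _ _ (Finset.mem_univ (0 : ZMod p))]
    push_cast
    gcongr
    have h2 : ∑ x ∈ Finset.univ.erase (0 : ZMod p), ((A x).card : ℝ) ≤
        ∑ x ∈ Finset.univ.erase (0 : ZMod p), ((p : ℝ) ^ (n - 1) * p ^ n + 5 * p ^ n) := by
      refine Finset.sum_le_sum fun c _ => ?_
      exact_mod_cast hA c
    refine h2.trans (le_of_eq ?_)
    rw [Finset.sum_const, Finset.card_erase_of_mem (Finset.mem_univ _), Finset.card_univ, ZMod.card,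
      nsmul_eq_mul, Nat.cast_sub (by omega)]
    simp
  have hchar1 : ∀ t : ZMod p,
      klSum (klPsi p L) (algebraMap (ZMod p) L t * a) (algebraMap (ZMod p) L t * b) =
      ∑ x ∈ Finset.univ.filter (fun x : L => x ≠ 0),
        ZMod.stdAddChar (t * Algebra.trace (ZMod p) L (a * x + b * x⁻¹)) := by
    intro t
    rw [klSum, Finset.sum_filter]
    refine Finset.sum_congr rfl fun x _ => ?_
    by_cases hx : x = 0
    · simp [hx]
    · rw [if_neg hx, if_pos hx, klPsi_apply]
      congr 1
      rw [← smul_eq_mul (a := t), ← map_smul, Algebra.smul_def]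
      congr 1; ring
  have htot : ∑ t : ZMod p,
      klSum (klPsi p L) (algebraMap (ZMod p) L t * a) (algebraMap (ZMod p) L t * b) =
      (p : ℂ) * (A 0).card := by
    rw [Finset.sum_congr rfl fun t _ => hchar1 t, Finset.sum_comm]
    have : ∀ x : L, ∑ t : ZMod p, ZMod.stdAddChar (t * Algebra.trace (ZMod p) L (a * x + b * x⁻¹))
        = if Algebra.trace (ZMod p) L (a * x + b * x⁻¹) = 0 then (p : ℂ) else 0 := by
      intro x
      rw [AddChar.sum_mulShift _ (ZMod.isPrimitive_stdAddChar p), ZMod.card]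
      simp
    rw [Finset.sum_congr rfl fun x _ => this x, ← Finset.sum_filter, Finset.filter_filter,
      Finset.sum_const, nsmul_eq_mul, mul_comm]
  have hzero : klSum (klPsi p L) (algebraMap (ZMod p) L 0 * a) (algebraMap (ZMod p) L 0 * b) =
      (p : ℂ) ^ (2 * n) - 1 := by
    rw [hchar1]
    simp only [zero_mul, AddChar.map_zero_eq_one, Finset.sum_const, nsmul_eq_mul, mul_one]
    rw [hcardne, Nat.cast_sub (Nat.one_le_pow _ _ (by omega))]; push_cast; rfl
  rw [← Finset.add_sum_erase _ _ (Finset.mem_univ (0 : ZMod p)), hzero] at htot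
  have hre := congrArg Complex.re (eq_sub_of_add_eq' htot)
  rw [Complex.re_sum] at hre
  rw [hre]
  have e1 : ((p : ℂ) * (A 0).card - ((p : ℂ) ^ (2 * n) - 1)) =
    (((p : ℝ) * (A 0).card - ((p : ℝ) ^ (2 * n) - 1) : ℝ) : ℂ) := by push_cast; ring
  rw [e1, Complex.ofReal_re]
  have e2 : (p : ℝ) * (p ^ (n - 1) * p ^ n) = p ^ (2 * n) := by
    rw [← mul_assoc, ← pow_succ', ← pow_add]; congr 1; omega
  have e3 := mul_le_mul_of_nonneg_left h0 (by positivity : (0 : ℝ) ≤ p)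
  have hp' : (3 : ℝ) ≤ p := by exact_mod_cast hp
  have e4 : (1 : ℝ) ≤ p ^ n := one_le_pow₀ (by linarith)
  have e5 : (p : ℝ) * ((A 0).card + (p - 1) * (p ^ (n - 1) * p ^ n + 5 * p ^ n)) =
     p * (A 0).card + (p - 1) * p ^ (2 * n) + 5 * (p * (p - 1)) * p ^ n := by
    rw [← e2]; ring
  rw [e5] at e3
  nlinarith

theorem kl_weil (p : ℕ) [Fact p.Prime] (hp : 3 ≤ p) (F : Type) [Field F] [Fintype F]
    [Algebra (ZMod p) F] (a b : F) (ha : a ≠ 0) (hb : b ≠ 0) :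
    ‖klSum (klPsi p F) a b‖ ≤ 2 * √(Fintype.card F) := by
  have hs : (0 : ℝ) < √(Fintype.card F) := by
    have : (0 : ℝ) < Fintype.card F := by exact_mod_cast Fintype.card_pos
    positivity
  by_contra hcon
  rw [not_le, kl_real, Complex.norm_real, Real.norm_eq_abs] at hcon
  have hy : 2 < |-(klSum (klPsi p F) a b).re / √(Fintype.card F)| := by
    rw [abs_div, abs_neg, abs_of_pos hs, lt_div_iff₀ hs]; exact hcon
  obtain ⟨j, hj⟩ := klIter_unbounded _ hy (5 * p ^ 2 + 2 * p)
  obtain ⟨L, i1, i2, i3, φ, hc, hL⟩ := kl_tower p (by omega) F (j + 1)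
  obtain ⟨e, he⟩ : ∃ e, Fintype.card F = p ^ e := by
    have h1 := Module.card_eq_pow_finrank (K := ZMod p) (V := F)
    rw [ZMod.card] at h1; exact ⟨_, h1⟩
  have he1 : 1 ≤ e := by
    by_contra h
    have : e = 0 := by omega
    have h2 := Fintype.one_lt_card (α := F)
    rw [he, this] at h2; simp at h2
  obtain ⟨n, hn⟩ : ∃ n, n = e * 2 ^ j := ⟨_, rfl⟩
  have hn1 : 1 ≤ n := by rw [hn]; exact Nat.mul_pos he1 (by positivity)
  have hcL : Fintype.card L = p ^ (2 * n) := by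
    rw [hc, he, hn, ← pow_mul]; congr 1; ring
  have hsq : √(Fintype.card L : ℝ) = p ^ n := by
    rw [hcL]; push_cast
    rw [mul_comm, pow_mul]; exact Real.sqrt_sq (by positivity)
  have hlow := kl_sum_lower p hp L n hn1 hcL (φ a) (φ b) (by simpa using ha)
  have hval : ∀ t ∈ Finset.univ.erase (0 : ZMod p),
      (klSum (klPsi p L) (algebraMap (ZMod p) L t * φ a) (algebraMap (ZMod p) L t * φ b)).re =
      - (p : ℝ) ^ n * klIter (-(klSum (klPsi p F) (algebraMap (ZMod p) F t * a)
        (algebraMap (ZMod p) F t * b)).re / √(Fintype.card F)) (j + 1) := by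
    intro t ht
    have ht0 : algebraMap (ZMod p) F t ≠ 0 := by simpa using ht
    have h3 : algebraMap (ZMod p) L t = φ (algebraMap (ZMod p) F t) :=
      RingHom.congr_fun (Subsingleton.elim (algebraMap (ZMod p) L) (φ.comp (algebraMap (ZMod p) F))) t
    rw [h3, ← map_mul, ← map_mul, hL _ _ (mul_ne_zero ht0 ha) (mul_ne_zero ht0 hb), hsq]
  rw [Finset.sum_congr rfl hval, ← Finset.mul_sum] at hlow
  have hpn : (0 : ℝ) < (p : ℝ) ^ n := by positivity
  have hle : ∑ t ∈ Finset.univ.erase (0 : ZMod p), klIter (-(klSum (klPsi p F) (algebraMap (ZMod p) F t * a)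
        (algebraMap (ZMod p) F t * b)).re / √(Fintype.card F)) (j + 1) ≤ 5 * (p : ℝ) ^ 2 := by
    by_contra h
    rw [not_le] at h
    nlinarith
  have h1mem : (1 : ZMod p) ∈ Finset.univ.erase (0 : ZMod p) := by simp
  rw [← Finset.add_sum_erase _ _ h1mem] at hle
  simp only [map_one, one_mul] at hle
  have hge : -(2 * (p : ℝ)) ≤ ∑ t ∈ (Finset.univ.erase (0 : ZMod p)).erase 1,
      klIter (-(klSum (klPsi p F) (algebraMap (ZMod p) F t * a)
        (algebraMap (ZMod p) F t * b)).re / √(Fintype.card F)) (j + 1) := by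
    have h4 : ∑ t ∈ (Finset.univ.erase (0 : ZMod p)).erase 1, (-2 : ℝ) ≤
      ∑ t ∈ (Finset.univ.erase (0 : ZMod p)).erase 1,
      klIter (-(klSum (klPsi p F) (algebraMap (ZMod p) F t * a)
        (algebraMap (ZMod p) F t * b)).re / √(Fintype.card F)) (j + 1) := by
      refine Finset.sum_le_sum fun t _ => ?_
      simp only [klIter]
      nlinarith [sq_nonneg (klIter (-(klSum (klPsi p F) (algebraMap (ZMod p) F t * a)
        (algebraMap (ZMod p) F t * b)).re / √(Fintype.card F)) j)]
    refine le_trans ?_ h4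
    rw [Finset.sum_const, nsmul_eq_mul]
    have h5 : ((Finset.univ.erase (0 : ZMod p)).erase 1).card ≤ p := by
      refine (Finset.card_le_card ((Finset.erase_subset _ _).trans (Finset.erase_subset _ _))).trans ?_
      rw [Finset.card_univ, ZMod.card]
    have h6 : (((Finset.univ.erase (0 : ZMod p)).erase 1).card : ℝ) ≤ p := by exact_mod_cast h5
    linarith
  linarith

end Weil

section Salie
open scoped Classical
variable {F : Type} [Field F] [Fintype F]

noncomputable def etc (x : F) : ℂ := ((quadraticChar F x : ℤ) : ℂ)

lemma etc_mul (x y : F) : etc (x * y) = etc x * etc y := by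
  unfold etc; rw [map_mul]; push_cast; rfl

lemma etc_zero : etc (0 : F) = 0 := by simp [etc]

lemma etc_sq (x : F) (hx : x ≠ 0) : etc x * etc x = 1 := by
  have := quadraticChar_sq_one hx
  unfold etc
  rw [← sq]
  exact_mod_cast this

lemma etc_norm (x : F) (hx : x ≠ 0) : ‖etc x‖ = 1 := by
  have h := congrArg norm (etc_sq x hx)
  rw [norm_mul, norm_one] at h
  nlinarith [norm_nonneg (etc x)]

lemma etc_inv (x : F) : etc x⁻¹ = etc x := by
  by_cases hx : x = 0
  · simp [hx]
  have h1 : etc x⁻¹ * etc x = 1 := by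
    rw [← etc_mul, inv_mul_cancel₀ hx]; simp [etc]
  have h2 := etc_sq x hx
  calc etc x⁻¹ = etc x⁻¹ * (etc x * etc x) := by rw [h2, mul_one]
    _ = etc x := by rw [← mul_assoc, h1, one_mul]

lemma etc_four : etc (4 : F) = etc (2 : F) * etc (2 : F) := by
  rw [← etc_mul]; norm_num

variable (hF : ringChar F ≠ 2) (ψ : AddChar F ℂ) (hψ : ψ.IsPrimitive)

noncomputable def sqG (ψ : AddChar F ℂ) : ℂ := ∑ x : F, ψ (x ^ 2)

include hψ in
lemma sum_lin (c : F) : ∑ x, ψ (c * x) = if c = 0 then (Fintype.card F : ℂ) else 0 := by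
  have := AddChar.sum_mulShift c hψ
  simp only [mul_comm c]
  rw [this]; split_ifs <;> simp

include hF hψ in
lemma sq_sum_eq (s : F) (hs : s ≠ 0) :
    ∑ x, ψ (s * x ^ 2) = ∑ w, ψ (s * w) * etc w := by
  rw [kl_sum_sq hF (fun w => ψ (s * w))]
  simp only [mul_add, mul_one, Finset.sum_add_distrib]
  rw [sum_lin ψ hψ, if_neg hs, zero_add]
  rfl

include hF hψ in
lemma gauss_scale (s : F) (hs : s ≠ 0) : ∑ x, ψ (s * x ^ 2) = etc s * sqG ψ := by
  have h1 : sqG ψ = ∑ w, ψ w * etc w := by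
    have := sq_sum_eq hF ψ hψ 1 one_ne_zero
    simpa [sqG] using this
  rw [sq_sum_eq hF ψ hψ s hs, h1, ← Equiv.sum_comp (Equiv.mulLeft₀ s hs) (fun w => ψ w * etc w),
    Finset.mul_sum]
  refine Finset.sum_congr rfl fun w _ => ?_
  rw [Equiv.mulLeft₀_apply, etc_mul]
  have := etc_sq s hs
  linear_combination -(ψ (s * w) * etc w) * this

include hF hψ in
lemma sqG_norm : ‖sqG ψ‖ = √(Fintype.card F) := by
  have h2 := kl_two_ne hF
  have h : sqG ψ * (starRingEnd ℂ) (sqG ψ) = Fintype.card F := by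
    rw [sqG, map_sum, Finset.sum_mul_sum, ← Fintype.sum_prod_type']
    have : ∀ y : F × F, ψ (y.1 ^ 2) * (starRingEnd ℂ) (ψ (y.2 ^ 2)) =
        ψ ((klEquiv h2 y).1 * (klEquiv h2 y).2) := by
      intro y
      rw [← AddChar.map_neg_eq_conj, ← AddChar.map_add_eq_mul]
      congr 1
      simp only [klEquiv, Equiv.coe_fn_mk]; ring
    rw [Finset.sum_congr rfl (fun y _ => this y),
      (klEquiv h2).sum_comp (fun y : F × F => ψ (y.1 * y.2)), Fintype.sum_prod_type]
    simp only [sum_lin ψ hψ]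
    simp
  rw [Complex.mul_conj, Complex.normSq_eq_norm_sq] at h
  have h' : ‖sqG ψ‖ ^ 2 = Fintype.card F := by exact_mod_cast h
  rw [← h', Real.sqrt_sq (norm_nonneg _)]

include hF hψ in
lemma salie (a b : F) (ha : a ≠ 0) :
    ‖∑ s, ψ (a * s + b * s⁻¹) * etc s‖ ≤ 2 * √(Fintype.card F) := by
  have hq : 0 < √(Fintype.card F : ℝ) := Real.sqrt_pos.mpr (by exact_mod_cast Fintype.card_pos)
  by_cases hb : b = 0
  · subst hb
    simp only [zero_mul, add_zero]
    rw [← sq_sum_eq hF ψ hψ a ha, gauss_scale hF ψ hψ a ha, norm_mul, etc_norm a ha,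
      sqG_norm hF ψ hψ]
    linarith
  have hb' : -b ≠ 0 := neg_ne_zero.mpr hb
  have key : (etc (-b) * sqG ψ) * ∑ s, ψ (a * s + b * s⁻¹) * etc s =
      ∑ u ∈ Finset.univ.filter (fun u : F => b * u ^ 2 = a), (Fintype.card F : ℂ) * ψ (2 * b * u) := by
    have e1 : ∀ s : F, (etc (-b) * sqG ψ) * (ψ (a * s + b * s⁻¹) * etc s) =
        ∑ u, (ψ ((a - b * u ^ 2) * s) * ψ (2 * b * u) - if s = 0 then ψ (2 * b * u) else 0) := by
      intro s
      by_cases hs : s = 0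
      · subst hs
        simp [etc_zero]
      simp only [if_neg hs, sub_zero]
      have h3 := gauss_scale hF ψ hψ (-b * s) (mul_ne_zero hb' hs)
      rw [etc_mul] at h3
      calc (etc (-b) * sqG ψ) * (ψ (a * s + b * s⁻¹) * etc s)
          = ψ (a * s + b * s⁻¹) * (etc (-b) * etc s * sqG ψ) := by ring
        _ = ∑ u, ψ ((a - b * u ^ 2) * s) * ψ (2 * b * u) := by
          rw [← h3, Finset.mul_sum, ← (Equiv.subRight s⁻¹).sum_comp]
          refine Finset.sum_congr rfl fun u _ => ?_
          rw [← AddChar.map_add_eq_mul, ← AddChar.map_add_eq_mul]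
          congr 1
          simp only [Equiv.subRight_apply]
          field_simp
          ring
    rw [Finset.mul_sum, Finset.sum_congr rfl (fun s _ => e1 s), Finset.sum_comm, Finset.sum_filter]
    have h2b : (2 * b) ≠ 0 := mul_ne_zero (kl_two_ne hF) hb
    simp only [Finset.sum_sub_distrib, ← Finset.sum_mul, sum_lin ψ hψ, Finset.sum_ite_eq',
      Finset.mem_univ, if_true, if_neg h2b, sub_zero, sub_eq_zero, eq_comm (a := a)]
    refine Finset.sum_congr rfl fun u _ => ?_
    split_ifs <;> simp
  have hcard : (Finset.univ.filter (fun u : F => b * u ^ 2 = a)).card ≤ 2 := by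
    by_cases hne : (Finset.univ.filter (fun u : F => b * u ^ 2 = a)).Nonempty
    · obtain ⟨u0, hu0⟩ := hne
      have hu0 := (Finset.mem_filter.mp hu0).2
      refine (Finset.card_le_card (t := {u0, -u0}) ?_).trans Finset.card_le_two
      intro u hu
      have hu := (Finset.mem_filter.mp hu).2
      have : u ^ 2 = u0 ^ 2 := mul_left_cancel₀ hb (hu.trans hu0.symm)
      simpa using sq_eq_sq_iff_eq_or_eq_neg.mp this
    · rw [Finset.not_nonempty_iff_eq_empty] at hne
      simp [hne]
  have hn := congrArg norm key
  rw [norm_mul, norm_mul, etc_norm _ hb', one_mul, sqG_norm hF ψ hψ] at hn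
  have hle : ‖∑ u ∈ Finset.univ.filter (fun u : F => b * u ^ 2 = a),
      (Fintype.card F : ℂ) * ψ (2 * b * u)‖ ≤ 2 * Fintype.card F := by
    refine (norm_sum_le _ _).trans ?_
    simp only [norm_mul, AddChar.norm_apply, mul_one, Complex.norm_natCast, Finset.sum_const,
      nsmul_eq_mul]
    gcongr
    exact_mod_cast hcard
  rw [← hn] at hle
  have hsq : √(Fintype.card F : ℝ) * √(Fintype.card F : ℝ) = Fintype.card F :=
    Real.mul_self_sqrt (by positivity)
  have : √(Fintype.card F : ℝ) * ‖∑ s, ψ (a * s + b * s⁻¹) * etc s‖ ≤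
    √(Fintype.card F : ℝ) * (2 * √(Fintype.card F : ℝ)) := by
    rw [mul_left_comm, hsq]; exact hle
  exact le_of_mul_le_mul_left this hq

include hF hψ in
lemma coord_id (s z : F) (hs : s ≠ 0) :
    ∑ m, ψ (-(4 * s)⁻¹ * m ^ 2 + m * z) = ψ (s * z ^ 2) * (etc (-1 : F) * etc s * sqG ψ) := by
  have h2 := kl_two_ne hF
  have h4 : (4 : F) ≠ 0 := by
    have := mul_ne_zero h2 h2; norm_num at this; exact this
  have hc : -(4 * s)⁻¹ ≠ 0 := neg_ne_zero.mpr (inv_ne_zero (mul_ne_zero h4 hs))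
  have h3 := gauss_scale hF ψ hψ (-(4 * s)⁻¹) hc
  have h5 : etc (-(4 * s)⁻¹) = etc (-1 : F) * etc s := by
    rw [neg_eq_neg_one_mul, etc_mul, etc_inv, etc_mul, etc_four, etc_sq 2 h2, one_mul]
  rw [h5] at h3
  rw [← h3, Finset.mul_sum, ← (Equiv.subRight (2 * s * z)).sum_comp
    (fun m => ψ (s * z ^ 2) * ψ (-(4 * s)⁻¹ * m ^ 2))]
  refine Finset.sum_congr rfl fun u _ => ?_
  rw [← AddChar.map_add_eq_mul]
  congr 1
  simp only [Equiv.subRight_apply]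
  field_simp
  ring

lemma psi_sum {ι : Type} (t : Finset ι) (f : ι → F) : ψ (∑ j ∈ t, f j) = ∏ j ∈ t, ψ (f j) := by
  induction t using Finset.induction_on with
  | empty => simp
  | insert a t ha ih => rw [Finset.sum_insert ha, Finset.prod_insert ha, AddChar.map_add_eq_mul, ih]

lemma psi_prod {d : ℕ} (f : Fin d → F → F) :
    ∑ m : Fin d → F, ψ (∑ j, f j (m j)) = ∏ j, ∑ x, ψ (f j x) := by
  simp only [psi_sum]
  rw [Finset.prod_univ_sum, Fintype.piFinset_univ]

include hF hψ in
lemma vec_id {d : ℕ} (s : F) (z : Fin d → F) (hs : s ≠ 0) :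
    etc s ^ d * ∑ m : Fin d → F, ψ (-(4 * s)⁻¹ * (∑ j, m j ^ 2) + ∑ j, m j * z j) =
      (etc (-1 : F) * sqG ψ) ^ d * ψ (s * ∑ j, z j ^ 2) := by
  have h1 := psi_prod ψ (fun j (x : F) => -(4 * s)⁻¹ * x ^ 2 + x * z j)
  simp only [Finset.sum_add_distrib, ← Finset.mul_sum] at h1
  rw [h1]
  simp only [coord_id hF ψ hψ s _ hs, Finset.prod_mul_distrib]
  rw [← psi_sum, ← Finset.mul_sum]
  simp only [Finset.prod_const, Finset.card_univ, Fintype.card_fin]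
  have := congrArg (· ^ d) (etc_sq s hs)
  simp only [mul_pow, one_pow] at this
  rw [mul_pow]
  linear_combination ψ (s * ∑ j, z j ^ 2) * etc (-1 : F) ^ d * sqG ψ ^ d * this

include hψ in
lemma vec_orth {d : ℕ} (z : Fin d → F) :
    ∑ m : Fin d → F, ψ (∑ j, m j * z j) = if z = 0 then (Fintype.card F : ℂ) ^ d else 0 := by
  have h1 := psi_prod ψ (fun j (x : F) => x * z j)
  rw [h1]
  simp only [mul_comm _ (z _), sum_lin ψ hψ]
  split_ifs with h
  · simp [h]
  · obtain ⟨j, hj⟩ := Function.ne_iff.mp h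
    exact Finset.prod_eq_zero (Finset.mem_univ j) (if_neg hj)

noncomputable def hatE {d : ℕ} (ψ : AddChar F ℂ) (E : Finset (Fin d → F)) (m : Fin d → F) : ℂ :=
  ∑ x ∈ E, ψ (∑ j, m j * x j)

lemma hatE_sq {d : ℕ} (E : Finset (Fin d → F)) (m : Fin d → F) :
    ((‖hatE ψ E m‖ ^ 2 : ℝ) : ℂ) = ∑ x ∈ E, ∑ y ∈ E, ψ (∑ j, m j * (x j - y j)) := by
  rw [← Complex.normSq_eq_norm_sq, ← Complex.mul_conj, hatE, map_sum, Finset.sum_mul_sum]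
  refine Finset.sum_congr rfl fun x _ => Finset.sum_congr rfl fun y _ => ?_
  rw [← AddChar.map_neg_eq_conj, ← AddChar.map_add_eq_mul]
  rw [← sub_eq_add_neg, ← Finset.sum_sub_distrib]
  simp only [mul_sub]

include hψ in
lemma plancherel {d : ℕ} (E : Finset (Fin d → F)) :
    ∑ m, ‖hatE ψ E m‖ ^ 2 = (Fintype.card F : ℝ) ^ d * E.card := by
  have : ((∑ m, ‖hatE ψ E m‖ ^ 2 : ℝ) : ℂ) = (Fintype.card F : ℂ) ^ d * E.card := by
    rw [Complex.ofReal_sum]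
    simp only [hatE_sq]
    rw [Finset.sum_comm]
    have h1 : ∀ x ∈ E, ∑ m : Fin d → F, ∑ y ∈ E, ψ (∑ j, m j * (x j - y j)) =
        (Fintype.card F : ℂ) ^ d := by
      intro x hx
      rw [Finset.sum_comm]
      have h2 : ∀ y : Fin d → F, ∑ m : Fin d → F, ψ (∑ j, m j * (x j - y j)) =
          if x = y then (Fintype.card F : ℂ) ^ d else 0 := by
        intro y
        have := vec_orth ψ hψ (x - y)
        simp only [Pi.sub_apply, sub_eq_zero] at this
        exact this
      simp only [h2]
      rw [Finset.sum_ite_eq, if_pos hx]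
    rw [Finset.sum_congr rfl h1, Finset.sum_const, nsmul_eq_mul, mul_comm]
  exact_mod_cast this

noncomputable def kap (ψ : AddChar F ℂ) (d : ℕ) (a b : F) : ℂ :=
  ∑ s, if s = 0 then 0 else etc s ^ d * ψ (a * s + b * s⁻¹)

noncomputable def remR {d : ℕ} (ψ : AddChar F ℂ) (E : Finset (Fin d → F)) : ℂ :=
  ∑ s, if s = 0 then 0 else ψ (-s) * ∑ x ∈ E, ∑ y ∈ E, ψ (s * ∑ j, (x j - y j) ^ 2)

include hF hψ in
lemma rem_id {d : ℕ} (E : Finset (Fin d → F)) :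
    (etc (-1 : F) * sqG ψ) ^ d * remR ψ E =
      ∑ m : Fin d → F, ((‖hatE ψ E m‖ ^ 2 : ℝ) : ℂ) * kap ψ d (-1) (-4⁻¹ * ∑ j, m j ^ 2) := by
  simp only [remR, kap, Finset.mul_sum (s := (Finset.univ : Finset F))]
  rw [Finset.sum_comm]
  refine Finset.sum_congr rfl fun s _ => ?_
  by_cases hs : s = 0
  · simp [hs]
  simp only [if_neg hs]
  have e1 : (etc (-1 : F) * sqG ψ) ^ d * (ψ (-s) * ∑ x ∈ E, ∑ y ∈ E, ψ (s * ∑ j, (x j - y j) ^ 2)) =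
      ∑ x ∈ E, ∑ y ∈ E, ∑ m : Fin d → F, etc s ^ d * (ψ (-s) *
        ψ (-(4 * s)⁻¹ * (∑ j, m j ^ 2) + ∑ j, m j * (x j - y j))) := by
    rw [mul_left_comm, Finset.mul_sum, Finset.mul_sum]
    refine Finset.sum_congr rfl fun x _ => ?_
    rw [Finset.mul_sum, Finset.mul_sum]
    refine Finset.sum_congr rfl fun y _ => ?_
    have := vec_id hF ψ hψ s (x - y) hs
    simp only [Pi.sub_apply] at this
    rw [← this, Finset.mul_sum, Finset.mul_sum]
    refine Finset.sum_congr rfl fun m _ => ?_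
    ring
  rw [e1]
  have e2 : ∀ x ∈ E, ∑ y ∈ E, ∑ m : Fin d → F, etc s ^ d * (ψ (-s) *
        ψ (-(4 * s)⁻¹ * (∑ j, m j ^ 2) + ∑ j, m j * (x j - y j))) =
      ∑ m : Fin d → F, ∑ y ∈ E, etc s ^ d * (ψ (-s) *
        ψ (-(4 * s)⁻¹ * (∑ j, m j ^ 2) + ∑ j, m j * (x j - y j))) :=
    fun x _ => Finset.sum_comm
  rw [Finset.sum_congr rfl e2, Finset.sum_comm]
  refine Finset.sum_congr rfl fun m _ => ?_
  rw [hatE_sq, Finset.sum_mul]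
  refine Finset.sum_congr rfl fun x _ => ?_
  rw [Finset.sum_mul]
  refine Finset.sum_congr rfl fun y _ => ?_
  have : ψ (-1 * s + -4⁻¹ * (∑ j, m j ^ 2) * s⁻¹) = ψ (-s) * ψ (-(4 * s)⁻¹ * (∑ j, m j ^ 2)) := by
    rw [← AddChar.map_add_eq_mul]
    congr 1
    rw [mul_inv]; ring
  rw [this, AddChar.map_add_eq_mul]
  ring

include hF hψ in
lemma count_id {d : ℕ} (E : Finset (Fin d → F)) :
    (Fintype.card F : ℂ) * ((E ×ˢ E).filter (fun p : (Fin d → F) × (Fin d → F) =>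
          ∑ j, (p.1 j - p.2 j) ^ 2 = 1)).card = (E.card : ℂ) ^ 2 + remR ψ E := by
  have h1 : (E.card : ℂ) ^ 2 + remR ψ E =
      ∑ s, ψ (-s) * ∑ x ∈ E, ∑ y ∈ E, ψ (s * ∑ j, (x j - y j) ^ 2) := by
    rw [← Finset.add_sum_erase _ _ (Finset.mem_univ (0 : F)), remR,
      ← Finset.add_sum_erase _ _ (Finset.mem_univ (0 : F))]
    simp only [if_true, zero_add]
    congr 1
    · simp [sq]
    · refine Finset.sum_congr rfl fun s hs => ?_
      rw [if_neg (Finset.ne_of_mem_erase hs)]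
  have h5 : ∀ s : F, ψ (-s) * ∑ x ∈ E, ∑ y ∈ E, ψ (s * ∑ j, (x j - y j) ^ 2) =
      ∑ x ∈ E, ∑ y ∈ E, ψ (-s) * ψ (s * ∑ j, (x j - y j) ^ 2) := by
    intro s
    rw [Finset.mul_sum]
    exact Finset.sum_congr rfl fun x _ => Finset.mul_sum _ _ _
  rw [h1, Finset.sum_congr rfl (fun s _ => h5 s), Finset.sum_comm]
  have e2 : ∀ x ∈ E, ∑ s, ∑ y ∈ E, ψ (-s) * ψ (s * ∑ j, (x j - y j) ^ 2) =
      ∑ y ∈ E, if ∑ j, (x j - y j) ^ 2 = 1 then (Fintype.card F : ℂ) else 0 := by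
    intro x _
    rw [Finset.sum_comm]
    refine Finset.sum_congr rfl fun y _ => ?_
    have := sum_lin ψ hψ (∑ j, (x j - y j) ^ 2 - 1)
    simp only [sub_eq_zero] at this
    rw [← this]
    refine Finset.sum_congr rfl fun s _ => ?_
    rw [← AddChar.map_add_eq_mul]
    congr 1; ring
  rw [Finset.sum_congr rfl e2, ← Finset.sum_product', Finset.card_filter]
  push_cast
  rw [Finset.mul_sum]
  refine Finset.sum_congr rfl fun y _ => ?_
  simp

lemma kap_bound (p : ℕ) [Fact p.Prime] (hp : 3 ≤ p) [Algebra (ZMod p) F] (hF : ringChar F ≠ 2)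
    (d : ℕ) (a b : F) (ha : a ≠ 0) :
    ‖kap (klPsi p F) d a b‖ ≤ 2 * √(Fintype.card F) := by
  have hψ := klPsi_primitive p F
  have hq : 1 ≤ √(Fintype.card F : ℝ) := by
    rw [Real.one_le_sqrt]; exact_mod_cast Fintype.card_pos
  rcases Nat.even_or_odd' d with ⟨k, rfl | rfl⟩
  · have h1 : kap (klPsi p F) (2 * k) a b = klSum (klPsi p F) a b := by
      unfold kap klSum
      refine Finset.sum_congr rfl fun s _ => ?_
      split_ifs with hs
      · rfl
      · rw [pow_mul, sq, etc_sq s hs, one_pow, one_mul]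
    rw [h1]
    by_cases hb : b = 0
    · have h2 : klSum (klPsi p F) a b = -1 := by
        have h3 := sum_lin (klPsi p F) hψ a
        rw [if_neg ha, ← Finset.add_sum_erase _ _ (Finset.mem_univ (0 : F))] at h3
        simp only [mul_zero, AddChar.map_zero_eq_one] at h3
        rw [klSum, ← Finset.add_sum_erase _ _ (Finset.mem_univ (0 : F)), if_pos rfl, zero_add,
          eq_neg_iff_add_eq_zero, add_comm, ← h3]
        congr 1
        refine Finset.sum_congr rfl fun s hs => ?_
        rw [if_neg (Finset.ne_of_mem_erase hs), hb, zero_mul, add_zero]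
      rw [h2, norm_neg, norm_one]; linarith
    · exact kl_weil p hp F a b ha hb
  · have h1 : kap (klPsi p F) (2 * k + 1) a b = ∑ s, klPsi p F (a * s + b * s⁻¹) * etc s := by
      unfold kap
      refine Finset.sum_congr rfl fun s _ => ?_
      split_ifs with hs
      · simp [hs, etc_zero]
      · rw [pow_succ, pow_mul, sq, etc_sq s hs, one_pow, one_mul, mul_comm]
    rw [h1]
    exact salie hF _ hψ a b ha

lemma rem_bound (p : ℕ) [Fact p.Prime] (hp : 3 ≤ p) [Algebra (ZMod p) F] (hF : ringChar F ≠ 2)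
    {d : ℕ} (E : Finset (Fin d → F)) :
    ‖remR (klPsi p F) E‖ ≤ 2 * √(Fintype.card F) ^ (d + 1) * E.card := by
  have hψ := klPsi_primitive p F
  have hq : 0 < √(Fintype.card F : ℝ) := Real.sqrt_pos.mpr (by exact_mod_cast Fintype.card_pos)
  have h1 := congrArg norm (rem_id hF (klPsi p F) hψ E)
  rw [norm_mul, norm_pow, norm_mul, etc_norm _ (neg_ne_zero.mpr one_ne_zero), one_mul,
    sqG_norm hF _ hψ] at h1
  have h2 : ‖∑ m : Fin d → F, ((‖hatE (klPsi p F) E m‖ ^ 2 : ℝ) : ℂ) *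
      kap (klPsi p F) d (-1) (-4⁻¹ * ∑ j, m j ^ 2)‖ ≤
      (Fintype.card F : ℝ) ^ d * E.card * (2 * √(Fintype.card F)) := by
    rw [← plancherel _ hψ, Finset.sum_mul]
    refine (norm_sum_le _ _).trans (Finset.sum_le_sum fun m _ => ?_)
    rw [norm_mul, Complex.norm_real, Real.norm_of_nonneg (by positivity)]
    gcongr
    exact kap_bound p hp hF d _ _ (neg_ne_zero.mpr one_ne_zero)
  rw [← h1] at h2
  have hsq : (Fintype.card F : ℝ) ^ d = √(Fintype.card F : ℝ) ^ d * √(Fintype.card F : ℝ) ^ d := by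
    rw [← mul_pow, Real.mul_self_sqrt (by positivity)]
  have h3 : √(Fintype.card F : ℝ) ^ d * ‖remR (klPsi p F) E‖ ≤ √(Fintype.card F : ℝ) ^ d *
      (2 * √(Fintype.card F) ^ (d + 1) * E.card) := by
    refine h2.trans (le_of_eq ?_)
    rw [hsq, pow_succ]; ring
  exact le_of_mul_le_mul_left h3 (by positivity)

end Salie
theorem statement17 {F : Type} [Field F] [Fintype F] [DecidableEq F]
    (q : ℕ) (hq : Fintype.card F = q) (hodd : Odd q)
    (d : ℕ) (hd : 2 ≤ d)
    (E : Finset (Fin d → F))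
    (hE : 4 * (q : ℝ) ^ (((d : ℝ) + 1) / 2) < (E.card : ℝ)) :
    (E.card : ℝ) ^ 2 / (2 * (q : ℝ)) ≤
      (((E ×ˢ E).filter (fun p : (Fin d → F) × (Fin d → F) =>
          ∑ j, (p.1 j - p.2 j) ^ 2 = 1)).card : ℝ) := by
  obtain ⟨p, hpc⟩ := CharP.exists F
  have hpF : Fact p.Prime := ⟨CharP.char_is_prime F p⟩
  letI : Algebra (ZMod p) F := ZMod.algebra F p
  obtain ⟨n, hn1, hn⟩ := FiniteField.card F p
  have hp2 : p ≠ 2 := by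
    rintro rfl
    rw [← hq, hn] at hodd
    have h3 := (Nat.odd_pow_iff n.pos.ne').mp hodd
    exact absurd h3 (by decide)
  have hp3 : 3 ≤ p := by have := hpF.out.two_le; omega
  have hF : ringChar F ≠ 2 := by rw [ringChar.eq F p]; exact hp2
  have hψ := klPsi_primitive p F
  have hb := rem_bound p hp3 hF E
  have hc := count_id hF (klPsi p F) hψ E
  have hqpos : (0 : ℝ) < q := by rw [← hq]; exact_mod_cast Fintype.card_pos
  set N : ℝ := (((E ×ˢ E).filter (fun p : (Fin d → F) × (Fin d → F) =>
          ∑ j, (p.1 j - p.2 j) ^ 2 = 1)).card : ℝ) with hN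
  have hc' : remR (klPsi p F) E = ((q * N - (E.card : ℝ) ^ 2 : ℝ) : ℂ) := by
    rw [hN]
    push_cast
    rw [← hq]
    rw [eq_sub_iff_add_eq, add_comm, ← hc]
    congr!
  rw [hc', Complex.norm_real, Real.norm_eq_abs, hq] at hb
  have hpow : √(q : ℝ) ^ (d + 1) = (q : ℝ) ^ (((d : ℝ) + 1) / 2) := by
    rw [Real.sqrt_eq_rpow, ← Real.rpow_natCast, ← Real.rpow_mul hqpos.le]
    congr 1; push_cast; ring
  rw [hpow] at hb
  have h1 := (abs_le.mp hb).1
  rw [div_le_iff₀ (by positivity)]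
  have hE0 : (0 : ℝ) ≤ E.card := by positivity
  nlinarith [mul_le_mul_of_nonneg_right hE.le hE0]
end
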